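/- arXiv:1209.1249 — 2 statements merged into one kernel-verified Lean document; each statement's English description precedes it below -/
import Mathlib

section
/- Borsuk–Ulam theorem: for every n ≥ 1 and every continuous map f from the unit sphere S^n ⊂ ℝ^{n+1} to ℝ^n, some pair of opposite points is mapped to a single point; that is, there exists x with ‖x‖ = 1 such that f(x) = f(−x). -/
open MvPolynomial

/-- An odd-dimensional module over a commutative real algebra yields a real character. -/
theorem exists_char_of_odd_module {Q : Type} [CommRing Q] [Algebra ℝ Q] :
    ∀ (m : ℕ) (V : Type) [AddCommGroup V] [Module Q V] [Module ℝ V] [IsScalarTower ℝ Q V]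
      [Module.Finite ℝ V], Module.finrank ℝ V = m → Odd m → Nonempty (Q →ₐ[ℝ] ℝ) := by
  intro m
  induction m using Nat.strong_induction_on with
  | _ m ih =>
  intro V _ _ _ _ _ hm hodd
  have hnt : Nontrivial V := by
    apply Module.nontrivial_of_finrank_pos (R := ℝ)
    rw [hm]; exact hodd.pos
  by_cases hs : IsSimpleModule Q V
  · obtain ⟨v, hv⟩ := exists_ne (0 : V)
    have hsurj := IsSimpleModule.toSpanSingleton_surjective Q hv
    have hmax : Ideal.IsMaximal (LinearMap.ker (LinearMap.toSpanSingleton Q V v)) :=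
      IsSimpleModule.ker_toSpanSingleton_isMaximal Q hv
    set M : Ideal Q := LinearMap.ker (LinearMap.toSpanSingleton Q V v) with hM
    have e : (Q ⧸ M) ≃ₗ[Q] V := LinearMap.quotKerEquivOfSurjective _ hsurj
    have e' : (Q ⧸ M) ≃ₗ[ℝ] V := e.restrictScalars ℝ
    let _ : Field (Q ⧸ M) := Ideal.Quotient.field M
    have hfin : Module.Finite ℝ (Q ⧸ M) := Module.Finite.equiv e'.symm
    have halg : Algebra.IsAlgebraic ℝ (Q ⧸ M) := Algebra.IsAlgebraic.of_finite ℝ _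
    rcases Real.nonempty_algEquiv_or (Q ⧸ M) with hφ | hφ
    · obtain ⟨φ⟩ := hφ
      exact ⟨φ.toAlgHom.comp (Ideal.Quotient.mkₐ ℝ M)⟩
    · obtain ⟨φ⟩ := hφ
      have h1 := e'.finrank_eq
      have h2 := φ.toLinearEquiv.finrank_eq
      rw [Complex.finrank_real_complex] at h2
      rw [hm] at h1
      have : m = 2 := by rw [← h1, ← h2]
      subst this
      exact absurd hodd (by decide)
  · have : ∃ W : Submodule Q V, W ≠ ⊥ ∧ W ≠ ⊤ := by
      by_contra! hcon
      apply hs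
      rw [isSimpleModule_iff]
      refine ⟨fun W => ?_⟩
      by_cases h : W = ⊥
      · exact Or.inl h
      · exact Or.inr (hcon W h)
    obtain ⟨W, hb, ht⟩ := this
    have hsum := Submodule.finrank_quotient_add_finrank (W.restrictScalars ℝ)
    have hfW : Module.Finite ℝ W := inferInstanceAs (Module.Finite ℝ (W.restrictScalars ℝ))
    have hfq : Module.Finite ℝ (V ⧸ W) :=
      inferInstanceAs (Module.Finite ℝ (V ⧸ W.restrictScalars ℝ))
    have hsum' : Module.finrank ℝ (V ⧸ W) + Module.finrank ℝ W = m := by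
      rw [← hm]; exact hsum
    have hWp : 0 < Module.finrank ℝ W := by
      have : Nontrivial W := Submodule.nontrivial_iff_ne_bot.2 hb
      exact Module.finrank_pos
    have hqp : 0 < Module.finrank ℝ (V ⧸ W) := by
      have : Nontrivial (V ⧸ W) := Submodule.Quotient.nontrivial_iff.2 ht
      exact Module.finrank_pos
    rw [← hsum', Nat.odd_add] at hodd
    by_cases ho : Odd (Module.finrank ℝ (V ⧸ W))
    · exact ih _ (by omega) (V ⧸ W) rfl ho
    · have : Odd (Module.finrank ℝ W) := by
        rw [← Nat.not_even_iff_odd]; exact fun h => ho (hodd.2 h)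
      exact ih _ (by omega) W rfl this

set_option linter.unusedSectionVars false

section tri
variable {σ : Type} [Fintype σ]

/-- Polynomials all of whose monomials have weight less than `m`. -/
noncomputable def wF (w : σ → ℕ) (m : ℕ) : Submodule ℝ (MvPolynomial σ ℝ) :=
  restrictSupport ℝ {a | Finsupp.weight w a < m}

theorem mem_wF {w : σ → ℕ} {m : ℕ} {p : MvPolynomial σ ℝ} :
    p ∈ wF w m ↔ ∀ a ∈ p.support, Finsupp.weight w a < m := by
  rw [wF, mem_restrictSupport_iff]; rfl

theorem wF_mono {w : σ → ℕ} {m k : ℕ} (h : m ≤ k) : wF w m ≤ wF w k :=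
  restrictSupport_mono _ (fun _ ha => lt_of_lt_of_le ha h)

theorem wF_mul {w : σ → ℕ} {m k : ℕ} {p q : MvPolynomial σ ℝ} (hp : p ∈ wF w m)
    (hq : q ∈ wF w (k + 1)) : p * q ∈ wF w (m + k) := by
  classical
  rw [mem_wF] at *
  intro a ha
  obtain ⟨b, hb, c, hc, rfl⟩ := Finset.mem_add.1 (support_mul p q ha)
  have := hp b hb
  have := hq c hc
  rw [map_add]; omega

theorem monomial_mem_wF {w : σ → ℕ} {m : ℕ} {a : σ →₀ ℕ} (c : ℝ) (h : Finsupp.weight w a < m) :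
    monomial a c ∈ wF w m := by
  rw [wF, monomial_mem_restrictSupport]; exact Or.inl h

theorem wF_zero {w : σ → ℕ} {p : MvPolynomial σ ℝ} (hp : p ∈ wF w 0) : p = 0 := by
  rw [mem_wF] at hp
  rw [← support_eq_empty, Finset.eq_empty_iff_forall_notMem]
  intro a ha
  exact absurd (hp a ha) (by omega)

theorem exists_wF (w : σ → ℕ) (p : MvPolynomial σ ℝ) : ∃ m, p ∈ wF w m := by
  refine ⟨p.support.sup (Finsupp.weight w) + 1, mem_wF.2 fun a ha => ?_⟩
  exact Nat.lt_succ_of_le (Finset.le_sup (f := Finsupp.weight w) ha)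

/-- `p` has leading monomial `a` for the weight `w`. -/
def wLead (w : σ → ℕ) (p : MvPolynomial σ ℝ) (a : σ →₀ ℕ) : Prop :=
  p - monomial a 1 ∈ wF w (Finsupp.weight w a)

theorem wLead.mem {w : σ → ℕ} {p : MvPolynomial σ ℝ} {a : σ →₀ ℕ} (h : wLead w p a) :
    p ∈ wF w (Finsupp.weight w a + 1) := by
  have := add_mem (wF_mono (Nat.le_succ _) h)
    (monomial_mem_wF (w := w) (a := a) 1 (Nat.lt_succ_self _))
  simpa using this

theorem wLead.mul {w : σ → ℕ} {p q : MvPolynomial σ ℝ} {a b : σ →₀ ℕ} (h : wLead w p a)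
    (h' : wLead w q b) : wLead w (p * q) (a + b) := by
  have e : p * q - monomial (a + b) 1
      = (p - monomial a 1) * q + (q - monomial b 1) * monomial a 1 := by
    have : (monomial (a + b) (1:ℝ)) = monomial a 1 * monomial b 1 := by
      rw [monomial_mul, one_mul]
    rw [this]; ring
  unfold wLead
  rw [e, map_add]
  refine add_mem (wF_mul h h'.mem) ?_
  rw [add_comm]
  exact wF_mul h' (monomial_mem_wF 1 (Nat.lt_succ_self _))

theorem wLead_monomial (w : σ → ℕ) (a : σ →₀ ℕ) : wLead w (monomial a 1) a := by
  unfold wLead; simp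

theorem wLead.pow {w : σ → ℕ} {p : MvPolynomial σ ℝ} {a : σ →₀ ℕ} (h : wLead w p a) (k : ℕ) :
    wLead w (p ^ k) (k • a) := by
  induction k with
  | zero => simpa using wLead_monomial w 0
  | succ k ih => rw [pow_succ, succ_nsmul]; exact ih.mul h

theorem wLead_prod {w : σ → ℕ} {ι : Type} (s : Finset ι) (p : ι → MvPolynomial σ ℝ)
    (a : ι → σ →₀ ℕ) (h : ∀ i, wLead w (p i) (a i)) :
    wLead w (∏ i ∈ s, p i) (∑ i ∈ s, a i) := by
  classical
  induction s using Finset.induction_on with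
  | empty => simpa using wLead_monomial w 0
  | insert i s hi ih => rw [Finset.prod_insert hi, Finset.sum_insert hi]; exact (h i).mul ih

/-- Remainder exponents. -/
noncomputable def modE (d : σ → ℕ) (a : σ →₀ ℕ) : σ →₀ ℕ :=
  Finsupp.equivFunOnFinite.symm (fun i => a i % d i)

@[simp] theorem modE_apply (d : σ → ℕ) (a : σ →₀ ℕ) (i : σ) : modE d a i = a i % d i := rfl

/-- The unitriangular map. -/
noncomputable def triPhi (d : σ → ℕ) (g : σ → MvPolynomial σ ℝ) :
    MvPolynomial σ ℝ →ₗ[ℝ] MvPolynomial σ ℝ :=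
  (basisMonomials σ ℝ).constr ℝ
    (fun a => monomial (modE d a) 1 * ∏ i, g i ^ (a i / d i))

theorem triPhi_monomial (d : σ → ℕ) (g : σ → MvPolynomial σ ℝ) (a : σ →₀ ℕ) :
    triPhi d g (monomial a 1) = monomial (modE d a) 1 * ∏ i, g i ^ (a i / d i) := by
  have := (basisMonomials σ ℝ).constr_basis ℝ
    (fun a => monomial (modE d a) (1:ℝ) * ∏ i, g i ^ (a i / d i)) a
  rw [coe_basisMonomials] at this
  exact this

theorem monomial_smul_one (a : σ →₀ ℕ) (c : ℝ) :
    (monomial a c : MvPolynomial σ ℝ) = c • monomial a 1 := by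
  rw [smul_monomial, smul_eq_mul, mul_one]

variable {w d : σ → ℕ} {g : σ → MvPolynomial σ ℝ}

theorem triPhi_lead (hg : ∀ i, wLead w (g i) (Finsupp.single i (d i))) (a : σ →₀ ℕ) :
    wLead w (triPhi d g (monomial a 1)) a := by
  classical
  rw [triPhi_monomial]
  have h := (wLead_monomial w (modE d a)).mul
    (wLead_prod Finset.univ (fun i => g i ^ (a i / d i)) _ (fun i => (hg i).pow (a i / d i)))
  convert h using 1
  ext j
  simp only [Finsupp.add_apply, modE_apply, Finsupp.finsetSum_apply, Finsupp.smul_apply,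
    Finsupp.single_apply, smul_eq_mul, mul_ite, mul_zero, Finset.sum_ite_eq', Finset.mem_univ,
    if_true]
  rw [mul_comm]; exact (Nat.mod_add_div _ _).symm

theorem triPhi_sub (hg : ∀ i, wLead w (g i) (Finsupp.single i (d i))) {m : ℕ}
    {p : MvPolynomial σ ℝ} (hp : p ∈ wF w (m + 1)) : triPhi d g p - p ∈ wF w m := by
  rw [p.as_sum, map_sum, ← Finset.sum_sub_distrib]
  refine Submodule.sum_mem _ fun a ha => ?_
  rw [monomial_smul_one, map_smul, ← smul_sub]
  refine Submodule.smul_mem _ _ (wF_mono ?_ (triPhi_lead hg a))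
  have := mem_wF.1 hp a ha
  omega

theorem triPhi_injective (hg : ∀ i, wLead w (g i) (Finsupp.single i (d i))) :
    Function.Injective (triPhi d g) := by
  rw [injective_iff_map_eq_zero]
  intro p hp
  obtain ⟨m, hm⟩ := exists_wF w p
  induction m with
  | zero => exact wF_zero hm
  | succ m ih =>
    apply ih
    have := triPhi_sub hg hm
    rw [hp, zero_sub] at this
    simpa using neg_mem this

theorem triPhi_surjective (hg : ∀ i, wLead w (g i) (Finsupp.single i (d i))) :
    Function.Surjective (triPhi d g) := by
  intro p
  obtain ⟨m, hm⟩ := exists_wF w p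
  induction m generalizing p with
  | zero => exact ⟨0, by rw [wF_zero hm, map_zero]⟩
  | succ m ih =>
    obtain ⟨q, hq⟩ := ih _ (triPhi_sub hg hm)
    exact ⟨p - q, by rw [map_sub, hq]; ring⟩

/-- Reduced polynomials. -/
noncomputable def redP (d : σ → ℕ) : Submodule ℝ (MvPolynomial σ ℝ) :=
  restrictSupport ℝ {a | ∀ i, a i < d i}

/-- Polynomials without reduced monomials. -/
noncomputable def nredP (d : σ → ℕ) : Submodule ℝ (MvPolynomial σ ℝ) :=
  restrictSupport ℝ {a | ¬ ∀ i, a i < d i}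

theorem triPhi_red {p : MvPolynomial σ ℝ} (hp : p ∈ redP d) : triPhi d g p = p := by
  rw [redP, mem_restrictSupport_iff] at hp
  conv_rhs => rw [p.as_sum]
  conv_lhs => rw [p.as_sum]
  rw [map_sum]
  refine Finset.sum_congr rfl fun a ha => ?_
  have h : ∀ i, a i < d i := hp ha
  rw [monomial_smul_one, map_smul, triPhi_monomial]
  congr 1
  have : modE d a = a := by ext i; simp [Nat.mod_eq_of_lt (h i)]
  rw [this]
  simp [Nat.div_eq_of_lt (h _)]

theorem triPhi_nred (hd : ∀ i, 0 < d i) {p : MvPolynomial σ ℝ} (hp : p ∈ nredP d) :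
    triPhi d g p ∈ Ideal.span (Set.range g) := by
  rw [nredP, mem_restrictSupport_iff] at hp
  rw [p.as_sum, map_sum]
  refine Ideal.sum_mem _ fun a ha => ?_
  have h : ¬ ∀ i, a i < d i := hp ha
  push Not at h
  obtain ⟨i, hi⟩ := h
  rw [monomial_smul_one, map_smul, triPhi_monomial, smul_eq_C_mul]
  refine Ideal.mul_mem_left _ _ (Ideal.mul_mem_left _ _ ?_)
  refine Ideal.mem_of_dvd _ (Finset.dvd_prod_of_mem _ (Finset.mem_univ i)) ?_
  refine Ideal.mem_of_dvd _ (dvd_pow_self (g i) ?_) (Ideal.subset_span ⟨i, rfl⟩)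
  exact (Nat.div_pos hi (hd i)).ne'

theorem exists_red (hd : ∀ i, 0 < d i) (hg : ∀ i, wLead w (g i) (Finsupp.single i (d i)))
    (p : MvPolynomial σ ℝ) : ∃ q ∈ redP d, p - q ∈ Ideal.span (Set.range g) := by
  obtain ⟨u, rfl⟩ := triPhi_surjective hg p
  induction u using MvPolynomial.induction_on' with
  | monomial a c =>
    by_cases h : ∀ i, a i < d i
    · refine ⟨monomial a c, ?_, ?_⟩
      · rw [redP, monomial_mem_restrictSupport]; exact Or.inl h
      · rw [triPhi_red, sub_self]
        · exact zero_mem _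
        · rw [redP, monomial_mem_restrictSupport]; exact Or.inl h
    · refine ⟨0, zero_mem _, ?_⟩
      rw [sub_zero]
      apply triPhi_nred hd
      rw [nredP, monomial_mem_restrictSupport]; exact Or.inl h
  | add p q hp hq =>
    obtain ⟨a, ha, ha'⟩ := hp
    obtain ⟨b, hb, hb'⟩ := hq
    refine ⟨a + b, add_mem ha hb, ?_⟩
    rw [map_add, add_sub_add_comm]
    exact add_mem ha' hb'

theorem triPhi_mul_pow (hd : ∀ i, 0 < d i) (i : σ) (u : MvPolynomial σ ℝ) :
    triPhi d g (u * monomial (Finsupp.single i (d i)) 1) = triPhi d g u * g i := by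
  classical
  induction u using MvPolynomial.induction_on' with
  | monomial a c =>
    rw [monomial_mul, monomial_smul_one, monomial_smul_one a c, map_smul, map_smul,
      triPhi_monomial, triPhi_monomial, mul_one, smul_mul_assoc, mul_assoc]
    congr 2
    · congr 1
      congr 1
      ext j
      by_cases hj : i = j
      · subst hj; simp
      · simp [hj]
    · rw [← Finset.mul_prod_erase _ _ (Finset.mem_univ i),
        ← Finset.mul_prod_erase _ (fun j => g j ^ (a j / d j)) (Finset.mem_univ i)]
      have h1 : (a + Finsupp.single i (d i)) i / d i = a i / d i + 1 := by
        simp [Nat.add_div_right _ (hd i)]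
      have h2 : ∏ x ∈ Finset.univ.erase i, g x ^ ((a + Finsupp.single i (d i)) x / d x)
          = ∏ x ∈ Finset.univ.erase i, g x ^ (a x / d x) := by
        refine Finset.prod_congr rfl fun j hj => ?_
        have : i ≠ j := (Finset.ne_of_mem_erase hj).symm
        simp [this]
      rw [h1, h2, pow_succ]; ring
  | add p q hp hq => rw [add_mul, map_add, hp, hq, map_add, add_mul]

theorem span_le_image (hd : ∀ i, 0 < d i) (hg : ∀ i, wLead w (g i) (Finsupp.single i (d i)))
    {p : MvPolynomial σ ℝ} (hp : p ∈ Ideal.span (Set.range g)) :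
    ∃ q ∈ nredP d, triPhi d g q = p := by
  classical
  obtain ⟨c, rfl⟩ := Ideal.mem_span_range_iff_exists_fun.1 hp
  choose u hu using fun i => triPhi_surjective hg (c i)
  refine ⟨∑ i, u i * monomial (Finsupp.single i (d i)) 1, ?_, ?_⟩
  · refine Submodule.sum_mem _ fun i _ => ?_
    rw [nredP, mem_restrictSupport_iff]
    intro a ha h
    obtain ⟨b, hb, e, he, rfl⟩ := Finset.mem_add.1 (support_mul _ _ ha)
    have he' := Finset.mem_singleton.1 (support_monomial_subset he)
    have := h i
    rw [he'] at this
    simp at this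
  · rw [map_sum]
    refine Finset.sum_congr rfl fun i _ => ?_
    rw [triPhi_mul_pow hd, hu]

theorem red_inter_span (hd : ∀ i, 0 < d i) (hg : ∀ i, wLead w (g i) (Finsupp.single i (d i)))
    {p : MvPolynomial σ ℝ} (hp : p ∈ Ideal.span (Set.range g)) (hr : p ∈ redP d) : p = 0 := by
  obtain ⟨q, hq, h⟩ := span_le_image hd hg hp
  have : q = p := triPhi_injective hg (h.trans (triPhi_red hr).symm)
  subst this
  rw [← support_eq_empty, Finset.eq_empty_iff_forall_notMem]
  intro a ha
  exact (hq ha) (hr ha)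

end tri

section parity
variable {σ : Type} [Fintype σ]

/-- The antipodal substitution. -/
noncomputable def tau (σ : Type) : MvPolynomial σ ℝ →ₐ[ℝ] MvPolynomial σ ℝ :=
  aeval (fun i => -X i)

theorem tau_X (i : σ) : tau σ (X i) = -X i := by simp [tau]

theorem tau_monomial (a : σ →₀ ℕ) (c : ℝ) :
    tau σ (monomial a c) = (-1 : ℝ) ^ a.degree • monomial a c := by
  rw [tau, aeval_monomial, monomial_eq, smul_eq_C_mul]
  have h : (a.prod fun i k => (-X i : MvPolynomial σ ℝ) ^ k)
      = C ((-1 : ℝ) ^ a.degree) * a.prod fun i k => X i ^ k := by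
    have : ∀ (i : σ) (k : ℕ), (-X i : MvPolynomial σ ℝ) ^ k = (-1) ^ k * X i ^ k :=
      fun i k => neg_pow _ _
    simp only [this, Finsupp.prod_mul]
    congr 1
    rw [Finsupp.prod, Finset.prod_pow_eq_pow_sum]
    simp only [map_pow, map_neg, map_one]
    rfl
  rw [h, algebraMap_eq]; ring

theorem tau_tau (p : MvPolynomial σ ℝ) : tau σ (tau σ p) = p := by
  have : (tau σ).comp (tau σ) = AlgHom.id ℝ _ := by
    ext i; simp [tau_X]
  exact DFunLike.congr_fun this p

theorem coeff_tau (p : MvPolynomial σ ℝ) (a : σ →₀ ℕ) :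
    coeff a (tau σ p) = (-1 : ℝ) ^ a.degree * coeff a p := by
  classical
  induction p using MvPolynomial.induction_on' with
  | monomial b c =>
    rw [tau_monomial, coeff_smul, coeff_monomial, smul_eq_mul]
    split_ifs with h
    · rw [h]
    · simp
  | add p q hp hq => rw [map_add, coeff_add, coeff_add, hp, hq]; ring

/-- Even polynomials. -/
noncomputable def evenS (σ : Type) : Subalgebra ℝ (MvPolynomial σ ℝ) :=
  AlgHom.equalizer (tau σ) (AlgHom.id ℝ _)

theorem mem_evenS {p : MvPolynomial σ ℝ} : p ∈ evenS σ ↔ tau σ p = p := Iff.rfl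

theorem mem_evenS_iff {p : MvPolynomial σ ℝ} :
    p ∈ evenS σ ↔ p ∈ restrictSupport ℝ {a : σ →₀ ℕ | Even a.degree} := by
  rw [mem_evenS, mem_restrictSupport_iff]
  constructor
  · intro h a ha
    by_contra ho
    have ho : Odd a.degree := Nat.not_even_iff_odd.1 ho
    have := coeff_tau p a
    rw [h, ho.neg_one_pow] at this
    exact mem_support_iff.1 ha (by linarith)
  · intro h
    ext a
    rw [coeff_tau]
    by_cases ha : a ∈ p.support
    · have : Even a.degree := h ha
      rw [this.neg_one_pow, one_mul]
    · rw [notMem_support_iff.1 ha, mul_zero]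

variable {w d : σ → ℕ} {g : σ → MvPolynomial σ ℝ}

/-- Reduced even exponents. -/
def redEven (d : σ → ℕ) : Set (σ →₀ ℕ) := {a | (∀ i, a i < d i) ∧ Even a.degree}

theorem mem_restrict_redEven {p : MvPolynomial σ ℝ} :
    p ∈ restrictSupport ℝ (redEven d) ↔ p ∈ redP d ∧ p ∈ evenS σ := by
  rw [mem_evenS_iff, redP]
  simp only [mem_restrictSupport_iff]
  exact ⟨fun h => ⟨fun a ha => (h ha).1, fun a ha => (h ha).2⟩, fun h a ha => ⟨h.1 ha, h.2 ha⟩⟩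

theorem tau_span (hτ : ∀ i, tau σ (g i) = g i ∨ tau σ (g i) = -g i) {p : MvPolynomial σ ℝ}
    (hp : p ∈ Ideal.span (Set.range g)) : tau σ p ∈ Ideal.span (Set.range g) := by
  have : Ideal.span (Set.range g) ≤ (Ideal.span (Set.range g)).comap (tau σ) := by
    rw [Ideal.span_le]
    rintro _ ⟨i, rfl⟩
    have hi : g i ∈ Ideal.span (Set.range g) := Ideal.subset_span ⟨i, rfl⟩
    rcases hτ i with h | h
    · simpa [h] using hi
    · simpa [h] using hi
  exact this hp

theorem tau_redP {p : MvPolynomial σ ℝ} (hp : p ∈ redP d) : tau σ p ∈ redP d := by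
  rw [redP, mem_restrictSupport_iff] at *
  intro a ha
  apply hp
  rw [Finset.mem_coe, mem_support_iff] at *
  rw [coeff_tau] at ha
  exact right_ne_zero_of_mul ha

theorem exists_char (hd : ∀ i, 0 < d i) (hg : ∀ i, wLead w (g i) (Finsupp.single i (d i)))
    (hτ : ∀ i, tau σ (g i) = g i ∨ tau σ (g i) = -g i) (hfin : (redEven d).Finite)
    (hodd : Odd (Nat.card (redEven d))) :
    ∃ χ : evenS σ →ₐ[ℝ] ℝ, ∀ p : evenS σ, (p : MvPolynomial σ ℝ) ∈ Ideal.span (Set.range g) →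
      χ p = 0 := by
  have : Finite (redEven d) := hfin
  set J : Ideal (evenS σ) := (Ideal.span (Set.range g)).comap (evenS σ).val with hJ
  have hle : restrictSupport ℝ (redEven d) ≤ Subalgebra.toSubmodule (evenS σ) :=
    fun p hp => (mem_restrict_redEven.1 hp).2
  let Ψ : restrictSupport ℝ (redEven d) →ₗ[ℝ] (evenS σ ⧸ J) :=
    (Ideal.Quotient.mkₐ ℝ J).toLinearMap ∘ₗ (Submodule.inclusion hle)
  have hinj : Function.Injective Ψ := by
    rw [injective_iff_map_eq_zero]
    rintro ⟨p, hp⟩ h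
    have h' : (⟨p, hle hp⟩ : evenS σ) ∈ J := Ideal.Quotient.eq_zero_iff_mem.1 h
    exact Subtype.ext (red_inter_span hd hg h' (mem_restrict_redEven.1 hp).1)
  have hsurj : Function.Surjective Ψ := by
    intro y
    obtain ⟨⟨p, hp⟩, rfl⟩ := Ideal.Quotient.mk_surjective y
    obtain ⟨q, hq, hpq⟩ := exists_red hd hg p
    have hmem : (1/2 : ℝ) • (q + tau σ q) ∈ restrictSupport ℝ (redEven d) := by
      rw [mem_restrict_redEven]
      refine ⟨Submodule.smul_mem _ _ (add_mem hq (tau_redP hq)), ?_⟩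
      rw [mem_evenS, map_smul, map_add, tau_tau, add_comm]
    refine ⟨⟨_, hmem⟩, ?_⟩
    refine (Ideal.Quotient.eq (I := J)).2 ?_
    change (1/2 : ℝ) • (q + tau σ q) - p ∈ Ideal.span (Set.range g)
    have h2 := tau_span hτ hpq
    rw [map_sub, mem_evenS.1 hp] at h2
    have h3 := Ideal.mul_mem_left _ (C (-1/2 : ℝ)) (add_mem hpq h2)
    convert h3 using 1
    rw [← smul_eq_C_mul]
    module
  have e := LinearEquiv.ofBijective Ψ ⟨hinj, hsurj⟩
  have hf : Module.Finite ℝ (restrictSupport ℝ (redEven d)) :=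
    Module.Finite.of_basis (basisRestrictSupport ℝ (redEven d))
  have hf' : Module.Finite ℝ (evenS σ ⧸ J) := Module.Finite.equiv e
  have hr : Module.finrank ℝ (evenS σ ⧸ J) = Nat.card (redEven d) := by
    rw [← e.finrank_eq, Module.finrank_eq_nat_card_basis (basisRestrictSupport ℝ (redEven d))]
  obtain ⟨χ⟩ := exists_char_of_odd_module (Q := evenS σ ⧸ J) _ (evenS σ ⧸ J) hr hodd
  refine ⟨χ.comp (Ideal.Quotient.mkₐ ℝ J), fun p hp => ?_⟩
  have : Ideal.Quotient.mkₐ ℝ J p = 0 := Ideal.Quotient.eq_zero_iff_mem.2 hp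
  rw [AlgHom.comp_apply, this, map_zero]

/-- A character of the even part comes from a real point up to sign. -/
theorem exists_point (χ : evenS σ →ₐ[ℝ] ℝ)
    (hsum : ∃ S : evenS σ, (S : MvPolynomial σ ℝ) = ∑ i, X i ^ 2 - 1 ∧ χ S = 0) :
    ∃ (x : σ → ℝ) (k : σ), x k ≠ 0 ∧ ∀ p : evenS σ, χ p = eval x (p : MvPolynomial σ ℝ) := by
  have hXX : ∀ i j : σ, (X i * X j : MvPolynomial σ ℝ) ∈ evenS σ := fun i j => by
    rw [mem_evenS, map_mul, tau_X, tau_X]; ring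
  let y : σ → σ → ℝ := fun i j => χ ⟨X i * X j, hXX i j⟩
  have hs1 : ∑ i, y i i = 1 := by
    obtain ⟨S, hS, h0⟩ := hsum
    have : S = ∑ i, (⟨X i * X i, hXX i i⟩ : evenS σ) - 1 := by
      apply Subtype.ext
      rw [hS]
      simp [pow_two]
    rw [this, map_sub, map_sum, map_one] at h0
    simp only [y]; linarith
  obtain ⟨k, hk⟩ : ∃ k, 0 < y k k := by
    by_contra! h
    have := Finset.sum_nonpos (s := Finset.univ) fun i _ => h i
    linarith
  set s := Real.sqrt (y k k) with hs
  have hs0 : 0 < s := Real.sqrt_pos.2 hk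
  have hss : s * s = y k k := Real.mul_self_sqrt hk.le
  let x : σ → ℝ := fun i => y k i / s
  have hyx : ∀ i, y k i = s * x i := fun i => by simp only [x]; field_simp
  have key : ∀ (a : σ →₀ ℕ) (c : ℝ),
      (∃ h : monomial a c ∈ evenS σ, χ ⟨_, h⟩ = eval x (monomial a c)) ∨
      (tau σ (monomial a c) = - monomial a c ∧ ∃ h : X k * monomial a c ∈ evenS σ,
        χ ⟨_, h⟩ = s * eval x (monomial a c)) := by
    intro a c
    refine MvPolynomial.induction_on_monomial (motive := fun p =>
      (∃ h : p ∈ evenS σ, χ ⟨_, h⟩ = eval x p) ∨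
      (tau σ p = - p ∧ ∃ h : X k * p ∈ evenS σ, χ ⟨_, h⟩ = s * eval x p)) ?_ ?_ a c
    · intro c
      left
      refine ⟨(evenS σ).algebraMap_mem c, ?_⟩
      rw [eval_C]
      exact χ.commutes c
    · intro p i hp
      rcases hp with ⟨h, he⟩ | ⟨ht, h, he⟩
      · right
        refine ⟨by rw [map_mul, mem_evenS.1 h, tau_X]; ring, ?_⟩
        have e : X k * (p * X i) = p * (X k * X i) := by ring
        have hm : X k * (p * X i) ∈ evenS σ := by rw [e]; exact mul_mem h (hXX k i)
        refine ⟨hm, ?_⟩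
        have : (⟨_, hm⟩ : evenS σ) = ⟨p, h⟩ * ⟨X k * X i, hXX k i⟩ := Subtype.ext e
        rw [this, map_mul, he, map_mul, eval_X]
        change _ * y k i = _
        rw [hyx]; ring
      · left
        have hm : p * X i ∈ evenS σ := by
          rw [mem_evenS, map_mul, ht, tau_X]; ring
        refine ⟨hm, ?_⟩
        have : (⟨_, hm⟩ : evenS σ) * ⟨X k * X k, hXX k k⟩
            = ⟨_, h⟩ * ⟨X k * X i, hXX k i⟩ := by
          apply Subtype.ext
          simp only [MulMemClass.mk_mul_mk]
          ring
        have h2 := congrArg χ this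
        rw [map_mul, map_mul, he] at h2
        change _ * y k k = _ * y k i at h2
        rw [← hss, hyx] at h2
        rw [map_mul, eval_X]
        have : s * s ≠ 0 := by positivity
        apply mul_right_cancel₀ this
        rw [h2]; ring
  have hE : ∀ p : MvPolynomial σ ℝ, p + tau σ p ∈ evenS σ := fun p => by
    rw [mem_evenS, map_add, tau_tau, add_comm]
  have key2 : ∀ p : MvPolynomial σ ℝ, χ ⟨_, hE p⟩ = eval x (p + tau σ p) := by
    intro p
    induction p using MvPolynomial.induction_on' with
    | monomial a c =>
      rcases key a c with ⟨h, he⟩ | ⟨ht, -⟩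
      · have : (⟨_, hE (monomial a c)⟩ : evenS σ) = ⟨_, h⟩ + ⟨_, h⟩ := by
          apply Subtype.ext
          simp [mem_evenS.1 h]
        rw [this, map_add, he, mem_evenS.1 h, map_add]
      · have : (⟨_, hE (monomial a c)⟩ : evenS σ) = 0 := by
          apply Subtype.ext
          simp [ht]
        rw [this, ht]; simp
    | add p q hp hq =>
      have : (⟨_, hE (p + q)⟩ : evenS σ) = ⟨_, hE p⟩ + ⟨_, hE q⟩ := by
        apply Subtype.ext
        simp only [AddMemClass.mk_add_mk, map_add]
        ring
      rw [this, map_add, hp, hq]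
      simp only [map_add]; ring
  refine ⟨x, k, ?_, ?_⟩
  · have : s * x k = s * s := by rw [← hyx, hss]
    intro h0
    rw [h0, mul_zero] at this
    exact (mul_pos hs0 hs0).ne this
  · rintro ⟨p, hp⟩
    have h := key2 p
    have : (⟨_, hE p⟩ : evenS σ) = ⟨p, hp⟩ + ⟨p, hp⟩ := by
      apply Subtype.ext
      simp [mem_evenS.1 hp]
    rw [this, map_add, mem_evenS.1 hp, map_add] at h
    linarith

end parity

theorem weight_single' {σ : Type} (w : σ → ℕ) (i : σ) (k : ℕ) :
    Finsupp.weight w (Finsupp.single i k) = k * w i := by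
  rw [Finsupp.weight_single, smul_eq_mul]

theorem card_redEven (n D : ℕ) (hD : Odd D) :
    (redEven (Fin.cons 2 (fun _ => D) : Fin (n + 1) → ℕ)).Finite ∧
    Odd (Nat.card (redEven (Fin.cons 2 (fun _ => D) : Fin (n + 1) → ℕ))) := by
  have hdeg : ∀ a : Fin (n + 1) →₀ ℕ, a.degree = a 0 + ∑ i : Fin n, a i.succ := fun a => by
    rw [Finsupp.degree_eq_sum, Fin.sum_univ_succ]
  let φ : redEven (Fin.cons 2 (fun _ => D) : Fin (n + 1) → ℕ) → (Fin n → Fin D) :=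
    fun a i => ⟨a.1 i.succ, by simpa using a.2.1 i.succ⟩
  have hφ : Function.Bijective φ := by
    constructor
    · rintro ⟨a, ha, ha'⟩ ⟨b, hb, hb'⟩ h
      have h1 : ∀ i : Fin n, a i.succ = b i.succ := fun i => congrArg Fin.val (congrFun h i)
      have a0 := ha 0
      have b0 := hb 0
      simp only [Fin.cons_zero] at a0 b0
      rw [hdeg, Nat.even_iff] at ha' hb'
      simp only [h1] at ha'
      apply Subtype.ext
      ext i
      refine Fin.cases ?_ h1 i
      change a 0 = b 0
      omega
    · intro f
      refine ⟨⟨Finsupp.equivFunOnFinite.symm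
        (Fin.cons ((∑ i, (f i : ℕ)) % 2) (fun i => (f i : ℕ))), ?_, ?_⟩, ?_⟩
      · intro i
        refine Fin.cases ?_ (fun i => ?_) i
        · simpa using Nat.mod_lt (∑ i, (f i : ℕ)) (by norm_num : 0 < 2)
        · simp
      · rw [hdeg, Nat.even_iff]
        simp only [Finsupp.equivFunOnFinite_symm_apply_apply, Fin.cons_zero, Fin.cons_succ]
        omega
      · funext i
        apply Fin.ext
        simp [φ]
  refine ⟨Finite.of_injective φ hφ.1, ?_⟩
  rw [Nat.card_eq_of_bijective φ hφ]
  simpa using hD.pow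

/-- Algebraic Borsuk-Ulam for perturbed odd polynomials. -/
theorem alg_BU (n : ℕ) (P : Fin n → MvPolynomial (Fin (n + 1)) ℝ)
    (hP : ∀ i, tau _ (P i) = -P i) (t : ℝ) (ht : 0 < t) :
    ∃ (D : ℕ) (x : Fin (n + 1) → ℝ), ∑ i, x i ^ 2 = 1 ∧
      ∀ i, eval x (P i) = - (t * x i.succ ^ D) := by
  let w : Fin (n + 1) → ℕ := Fin.cons 2 (fun _ => 1)
  choose m hm using fun i => exists_wF w (P i)
  let D := 2 * (∑ i, m i) + 1
  have hD : Odd D := ⟨_, rfl⟩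
  have hmD : ∀ i, m i ≤ D := fun i => by
    have := Finset.single_le_sum (f := m) (fun _ _ => Nat.zero_le _) (Finset.mem_univ i)
    omega
  let d : Fin (n + 1) → ℕ := Fin.cons 2 (fun _ => D)
  let g : Fin (n + 1) → MvPolynomial (Fin (n + 1)) ℝ :=
    Fin.cons (∑ i, X i ^ 2 - 1) (fun i => X i.succ ^ D + t⁻¹ • P i)
  have hd : ∀ i, 0 < d i := by
    intro i
    refine Fin.cases ?_ (fun i => ?_) i
    · simp [d]
    · simpa [d] using hD.pos
  have hg : ∀ i, wLead w (g i) (Finsupp.single i (d i)) := by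
    intro i
    refine Fin.cases ?_ (fun i => ?_) i
    · unfold wLead
      simp only [g, d, Fin.cons_zero]
      have e : (∑ i, X i ^ 2 - 1 - monomial (Finsupp.single 0 2) 1 :
          MvPolynomial (Fin (n + 1)) ℝ)
          = ∑ i : Fin n, monomial (Finsupp.single i.succ 2) 1 - monomial 0 1 := by
        rw [Fin.sum_univ_succ]
        simp only [X_pow_eq_monomial]
        have : (1 : MvPolynomial (Fin (n + 1)) ℝ) = monomial 0 1 := rfl
        rw [this]; ring
      rw [e, weight_single']
      refine sub_mem (Submodule.sum_mem _ fun i _ => ?_) ?_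
      · apply monomial_mem_wF
        rw [weight_single']; simp [w]
      · apply monomial_mem_wF
        simp [w]
    · unfold wLead
      simp only [g, d, Fin.cons_succ]
      rw [X_pow_eq_monomial, add_sub_cancel_left, weight_single']
      refine Submodule.smul_mem _ _ (wF_mono ?_ (hm i))
      simpa [w] using hmD i
  have hτ : ∀ i, tau _ (g i) = g i ∨ tau _ (g i) = -g i := by
    intro i
    refine Fin.cases ?_ (fun i => ?_) i
    · left
      simp [g, tau_X]
    · right
      simp only [g, Fin.cons_succ]
      rw [map_add, map_pow, map_smul, tau_X, hP, hD.neg_pow, smul_neg]; ring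
  obtain ⟨hfin, hodd⟩ := card_redEven n D hD
  obtain ⟨χ, hχ⟩ := exists_char (w := w) (d := d) (g := g) hd hg hτ hfin hodd
  have hgs : ∀ i, g i ∈ Ideal.span (Set.range g) := fun i => Ideal.subset_span ⟨i, rfl⟩
  have hg0 : g 0 ∈ evenS _ := by
    rw [mem_evenS]; simp [g, tau_X]
  obtain ⟨x, k, hk, hx⟩ := exists_point χ ⟨⟨g 0, hg0⟩, rfl, hχ _ (hgs 0)⟩
  refine ⟨D, x, ?_, fun i => ?_⟩
  · have h := hχ ⟨g 0, hg0⟩ (hgs 0)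
    rw [hx] at h
    simp only [g, Fin.cons_zero, map_sub, map_sum, map_pow, eval_X, map_one] at h
    linarith
  · have he : X k * g i.succ ∈ evenS _ := by
      rw [mem_evenS, map_mul, tau_X]
      have : tau _ (g i.succ) = -g i.succ := by
        simp only [g, Fin.cons_succ]
        rw [map_add, map_pow, map_smul, tau_X, hP, hD.neg_pow, smul_neg]; ring
      rw [this]; ring
    have h := hχ ⟨_, he⟩ (Ideal.mul_mem_left _ _ (hgs i.succ))
    rw [hx, map_mul, eval_X] at h
    have h' := (mul_eq_zero.1 h).resolve_left hk
    simp only [g, Fin.cons_succ, map_add, map_pow, eval_X, smul_eval] at h'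
    field_simp at h'
    linarith

/-- Polynomial approximation on the sphere by odd polynomials. -/
theorem odd_approx (n : ℕ)
    (h : Metric.sphere (0 : EuclideanSpace ℝ (Fin (n + 1))) 1 → ℝ) (hc : Continuous h)
    (ho : ∀ x, h (-x) = - h x) (ε : ℝ) (hε : 0 < ε) :
    ∃ P : MvPolynomial (Fin (n + 1)) ℝ, tau _ P = -P ∧
      ∀ x : Metric.sphere (0 : EuclideanSpace ℝ (Fin (n + 1))) 1,
        |eval (fun i => x.1 i) P - h x| < ε := by
  let c : Fin (n + 1) → C(Metric.sphere (0 : EuclideanSpace ℝ (Fin (n + 1))) 1, ℝ) :=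
    fun i => ⟨fun x => x.1 i, by fun_prop⟩
  let A := (aeval (R := ℝ) c).range
  have hA : A.SeparatesPoints := by
    intro x y hxy
    have : ∃ i, x.1 i ≠ y.1 i := by
      by_contra! hcon
      exact hxy (Subtype.ext (by ext i; exact hcon i))
    obtain ⟨i, hi⟩ := this
    exact ⟨c i, ⟨c i, ⟨X i, by simp⟩, rfl⟩, hi⟩
  obtain ⟨⟨q, ⟨Q, hQ⟩⟩, hq⟩ :=
    ContinuousMap.exists_mem_subalgebra_near_continuous_of_separatesPoints A hA h hc ε hε
  have hev : ∀ (Q : MvPolynomial (Fin (n + 1)) ℝ) x, aeval c Q x = eval (fun i => x.1 i) Q := by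
    intro Q x
    have : ((ContinuousMap.evalAlgHom ℝ ℝ x).comp (aeval c)) = aeval (fun i => x.1 i) := by
      ext i
      simp [c]
    have h2 := DFunLike.congr_fun this Q
    rw [← coe_aeval_eq_eval]
    exact h2
  have hq' : ∀ x, |eval (fun i => x.1 i) Q - h x| < ε := by
    intro x
    have := hq x
    rw [Real.norm_eq_abs] at this
    rw [← hev]
    change aeval c Q = q at hQ
    rw [hQ]; exact this
  refine ⟨(1/2 : ℝ) • (Q - tau _ Q), ?_, fun x => ?_⟩
  · rw [map_smul, map_sub, tau_tau]; module
  · have e : eval (fun i => x.1 i) (tau _ Q)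
        = eval (fun i => (-x : Metric.sphere (0 : EuclideanSpace ℝ (Fin (n + 1))) 1).1 i) Q := by
      rw [tau, ← coe_aeval_eq_eval, ← coe_aeval_eq_eval]
      change ((aeval fun i => x.1 i).comp (aeval fun i => -X i)) Q = aeval _ Q
      congr 1
      ext i
      simp
    have h1 := abs_lt.1 (hq' x)
    have h2 := abs_lt.1 (hq' (-x))
    rw [ho] at h2
    rw [smul_eval, map_sub, e, abs_lt]
    constructor <;> linarith [h1.1, h1.2, h2.1, h2.2]

/-- **Borsuk–Ulam theorem**: for every `n ≥ 1` and every continuous map `f` from the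
unit sphere `S^n ⊂ ℝ^{n+1}` to `ℝ^n`, some pair of opposite points is mapped to a
single point. -/
theorem borsuk_ulam (n : ℕ) (hn : 1 ≤ n)
    (f : Metric.sphere (0 : EuclideanSpace ℝ (Fin (n + 1))) 1 → EuclideanSpace ℝ (Fin n))
    (hf : Continuous f) :
    ∃ x : Metric.sphere (0 : EuclideanSpace ℝ (Fin (n + 1))) 1, f x = f (-x) := by
  by_contra! hcon
  let h : Metric.sphere (0 : EuclideanSpace ℝ (Fin (n + 1))) 1 → EuclideanSpace ℝ (Fin n) :=
    fun x => f x - f (-x)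
  have hc : Continuous h := hf.sub (hf.comp continuous_neg)
  let N : Metric.sphere (0 : EuclideanSpace ℝ (Fin (n + 1))) 1 → ℝ := fun x => ∑ i, |h x i|
  have hN : Continuous N := by
    refine continuous_finsetSum _ fun i _ => ?_
    exact ((EuclideanSpace.proj (𝕜 := ℝ) i).continuous.comp hc).abs
  have hne : (Set.univ : Set (Metric.sphere (0 : EuclideanSpace ℝ (Fin (n + 1))) 1)).Nonempty :=
    ⟨⟨EuclideanSpace.single 0 1, by simp⟩, trivial⟩
  obtain ⟨x₀, -, hx₀⟩ := isCompact_univ.exists_isMinOn hne hN.continuousOn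
  have hpos : 0 < N x₀ := by
    have h0 : h x₀ ≠ 0 := sub_ne_zero.2 (hcon x₀)
    have : ∃ i, h x₀ i ≠ 0 := by
      by_contra! hz
      exact h0 (by ext i; exact hz i)
    obtain ⟨i, hi⟩ := this
    exact lt_of_lt_of_le (abs_pos.2 hi)
      (Finset.single_le_sum (f := fun i => |h x₀ i|) (fun _ _ => abs_nonneg _) (Finset.mem_univ i))
  have hn0 : (0 : ℝ) < n := by exact_mod_cast hn
  set ε : ℝ := N x₀ / (2 * n) with hε
  have hεp : 0 < ε := by positivity
  choose P hPodd hP using fun i : Fin n => odd_approx n (fun x => h x i)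
    ((EuclideanSpace.proj (𝕜 := ℝ) i).continuous.comp hc)
    (fun x => by simp [h]) ε hεp
  obtain ⟨D, x, hx, hz⟩ := alg_BU n P hPodd ε hεp
  let X : Metric.sphere (0 : EuclideanSpace ℝ (Fin (n + 1))) 1 :=
    ⟨WithLp.toLp 2 x, by
      rw [mem_sphere_zero_iff_norm, EuclideanSpace.norm_eq]
      simp [hx]⟩
  have hlt : N X < N x₀ := by
    have h1 : ∀ i, |h X i| < 2 * ε := by
      intro i
      have h2 : |eval x (P i) - h X i| < ε := hP i X
      have h3 : |x i.succ| ≤ 1 := by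
        rw [← sq_le_one_iff_abs_le_one, ← hx]
        exact Finset.single_le_sum (f := fun i => x i ^ 2) (fun _ _ => sq_nonneg _)
          (Finset.mem_univ i.succ)
      have h4 : |x i.succ ^ D| ≤ 1 := by
        rw [abs_pow]; exact pow_le_one₀ (abs_nonneg _) h3
      rw [hz] at h2
      have h5 := abs_lt.1 h2
      have h6 := abs_le.1 h4
      rw [abs_lt]
      constructor <;> nlinarith [h5.1, h5.2, h6.1, h6.2]
    have : Nonempty (Fin n) := ⟨⟨0, hn⟩⟩
    calc N X < ∑ _i : Fin n, 2 * ε :=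
          Finset.sum_lt_sum_of_nonempty Finset.univ_nonempty (fun i _ => h1 i)
      _ = N x₀ := by
          rw [Finset.sum_const, Finset.card_univ, Fintype.card_fin, nsmul_eq_mul, hε]
          field_simp
  exact absurd (hx₀ (Set.mem_univ X)) (not_le.2 hlt)
end

section
/- Hopf's theorem for the round sphere: for every n ≥ 1, every continuous map f : S^n → ℝ^n and every prescribed δ > 0, there exist a unit vector x ∈ ℝ^{n+1} and a unit vector u ∈ ℝ^{n+1} orthogonal to x (⟪x,u⟫ = 0) such that f(x) = f(cos δ · x + sin δ · u); i.e., the two endpoints of some geodesic arc of length δ on S^n are mapped by f to a single point. -/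
open scoped RealInnerProductSpace
namespace HopfSphere

section Chains
variable {V : Type*}

/-- Mod 2 chains on lists of points. -/
abbrev Ch (V : Type*) := List V →₀ ZMod 2

/-- Cone operator: prepend a vertex. -/
noncomputable def consL (x : V) : Ch V →ₗ[ZMod 2] Ch V :=
  Finsupp.lmapDomain (ZMod 2) (ZMod 2) (List.cons x)

lemma consL_single (x : V) (l : List V) (a : ZMod 2) :
    consL x (Finsupp.single l a) = Finsupp.single (x :: l) a := by
  simp [consL]

/-- Augmented boundary of a list. -/
noncomputable def bd0 : List V → Ch V
  | [] => 0
  | x :: l => Finsupp.single l 1 + consL x (bd0 l)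

/-- Augmented boundary. -/
noncomputable def bd : Ch V →ₗ[ZMod 2] Ch V := Finsupp.linearCombination (ZMod 2) bd0

lemma bd_single (l : List V) : bd (Finsupp.single l 1) = bd0 l := by
  simp [bd]

lemma ch_add_self (c : Ch V) : c + c = 0 := ZModModule.add_self c

lemma bd_consL (x : V) (c : Ch V) : bd (consL x c) = c + consL x (bd c) := by
  have : bd ∘ₗ consL x = LinearMap.id + consL x ∘ₗ bd := by
    apply Finsupp.lhom_ext'
    intro l
    ext1
    simp only [LinearMap.comp_apply, Finsupp.lsingle_apply, consL_single, bd_single,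
      LinearMap.add_apply, LinearMap.id_apply, bd0]
  exact LinearMap.congr_fun this c

lemma bd_bd0 (l : List V) : bd (bd0 l) = 0 := by
  induction l with
  | nil => simp [bd0]
  | cons x l ih =>
    rw [bd0, map_add, bd_single, bd_consL, ih, map_zero, add_zero, ch_add_self]

lemma bd_bd (c : Ch V) : bd (bd c) = 0 := by
  have : bd ∘ₗ bd = (0 : Ch V →ₗ[ZMod 2] Ch V) := by
    apply Finsupp.lhom_ext'
    intro l
    ext1
    simp only [LinearMap.comp_apply, Finsupp.lsingle_apply, bd_single, bd_bd0,
      LinearMap.zero_apply]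
  exact LinearMap.congr_fun this c

/-- Subdivision operator with centre function `b`. -/
noncomputable def sd (b : List V → V) : ℕ → Ch V →ₗ[ZMod 2] Ch V
  | 0 => LinearMap.id
  | k + 1 => Finsupp.linearCombination (ZMod 2) (fun σ => consL (b σ) (sd b k (bd0 σ)))

lemma sd_single (b : List V → V) (k : ℕ) (σ : List V) :
    sd b (k + 1) (Finsupp.single σ 1) = consL (b σ) (sd b k (bd0 σ)) := by
  simp [sd]

lemma bd_sd (b : List V → V) (k : ℕ) (c : Ch V) : bd (sd b (k + 1) c) = sd b k (bd c) := by
  induction k generalizing c with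
  | zero =>
    have : bd ∘ₗ sd b 1 = sd b 0 ∘ₗ bd := by
      apply Finsupp.lhom_ext'
      intro l
      ext1
      simp only [LinearMap.comp_apply, Finsupp.lsingle_apply, bd_single, sd_single, bd_consL]
      simp [sd, bd_bd0]
    exact LinearMap.congr_fun this c
  | succ k ih =>
    have : bd ∘ₗ sd b (k + 2) = sd b (k + 1) ∘ₗ bd := by
      apply Finsupp.lhom_ext'
      intro l
      ext1
      simp only [LinearMap.comp_apply, Finsupp.lsingle_apply, bd_single, sd_single, bd_consL]
      simp [ih, bd_bd0]
    exact LinearMap.congr_fun this c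

variable [AddCommGroup V]

/-- Antipodal map on chains. -/
noncomputable def anti : Ch V →ₗ[ZMod 2] Ch V :=
  Finsupp.lmapDomain (ZMod 2) (ZMod 2) (List.map (fun v => -v))

lemma anti_single (l : List V) (a : ZMod 2) :
    anti (Finsupp.single l a) = Finsupp.single (l.map (fun v => -v)) a := by
  simp [anti]

lemma anti_consL (x : V) (c : Ch V) : anti (consL x c) = consL (-x) (anti c) := by
  have : anti ∘ₗ consL x = consL (-x) ∘ₗ anti := by
    apply Finsupp.lhom_ext'
    intro l
    ext1
    simp only [LinearMap.comp_apply, Finsupp.lsingle_apply, consL_single, anti_single, List.map]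
  exact LinearMap.congr_fun this c

lemma anti_anti (c : Ch V) : anti (anti c) = c := by
  have : anti ∘ₗ anti = (LinearMap.id : Ch V →ₗ[ZMod 2] Ch V) := by
    apply Finsupp.lhom_ext'
    intro l
    ext1
    simp only [LinearMap.comp_apply, Finsupp.lsingle_apply, anti_single, List.map_map]
    simp
  exact LinearMap.congr_fun this c

lemma bd0_map (l : List V) : bd0 (l.map (fun v => -v)) = anti (bd0 l) := by
  induction l with
  | nil => simp [bd0]
  | cons x l ih => simp only [List.map, bd0, ih, map_add, anti_single, anti_consL]

lemma bd_anti (c : Ch V) : bd (anti c) = anti (bd c) := by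
  have : bd ∘ₗ anti = anti ∘ₗ (bd : Ch V →ₗ[ZMod 2] Ch V) := by
    apply Finsupp.lhom_ext'
    intro l
    ext1
    simp only [LinearMap.comp_apply, Finsupp.lsingle_apply, anti_single, bd_single, bd0_map]
  exact LinearMap.congr_fun this c

lemma sd_anti (b : List V → V) (hb : ∀ l, b (l.map (fun v => -v)) = - b l) (k : ℕ) (c : Ch V) :
    sd b k (anti c) = anti (sd b k c) := by
  induction k generalizing c with
  | zero => simp [sd]
  | succ k ih =>
    have : sd b (k + 1) ∘ₗ anti = anti ∘ₗ sd b (k + 1) := by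
      apply Finsupp.lhom_ext'
      intro l
      ext1
      simp only [LinearMap.comp_apply, Finsupp.lsingle_apply, anti_single, sd_single, bd0_map, hb,
        ih, anti_consL]
    exact LinearMap.congr_fun this c

/-- Hemisphere chains of the cross-polytope. -/
noncomputable def hem (e : ℕ → V) : ℕ → Ch V
  | 0 => Finsupp.single [e 0] 1
  | k + 1 => consL (e (k + 1)) (hem e k + anti (hem e k))

lemma bd_hem_zero (e : ℕ → V) : bd (hem e 0) = Finsupp.single [] 1 := by
  rw [hem, bd_single, bd0, bd0, map_zero, add_zero]

lemma bd_hem_succ (e : ℕ → V) (k : ℕ) : bd (hem e (k + 1)) = hem e k + anti (hem e k) := by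
  have key : bd (hem e k + anti (hem e k)) = 0 := by
    cases k with
    | zero =>
      rw [map_add, bd_anti, bd_hem_zero, anti_single, List.map_nil, ch_add_self]
    | succ k =>
      have : bd (hem e (k + 1)) = hem e k + anti (hem e k) := by
        have := bd_hem_succ e k
        exact this
      rw [map_add, bd_anti, this, map_add, anti_anti, add_comm (anti _), ch_add_self]
  rw [hem, bd_consL, key, map_zero, add_zero]

/-- Subdivided hemispheres. -/
noncomputable def hs (b : List V → V) (e : ℕ → V) (m k : ℕ) : Ch V := (sd b (k + 1))^[m] (hem e k)

lemma bd_hs_zero (b : List V → V) (e : ℕ → V) (m : ℕ) :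
    bd (hs b e m 0) = Finsupp.single [] 1 := by
  induction m with
  | zero => simp [hs, bd_hem_zero]
  | succ m ih =>
    rw [hs] at ih ⊢
    rw [Function.iterate_succ_apply', bd_sd, ih]
    simp [sd]

lemma bd_hs_succ (b : List V → V) (hb : ∀ l, b (l.map (fun v => -v)) = - b l) (e : ℕ → V)
    (m k : ℕ) : bd (hs b e m (k + 1)) = hs b e m k + anti (hs b e m k) := by
  induction m with
  | zero => simp [hs, bd_hem_succ]
  | succ m ih =>
    simp only [hs] at ih ⊢
    rw [Function.iterate_succ_apply', bd_sd, ih, map_add, sd_anti b hb,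
      Function.iterate_succ_apply']

end Chains

section Fan

/-- Sum of `F` over all lists with one entry removed. -/
def dl {α : Type*} (F : List α → ZMod 2) : List α → ZMod 2
  | [] => 0
  | x :: l => F l + dl (fun m => F (x :: m)) l

lemma dl_mul {α : Type*} (a : ZMod 2) (F : List α → ZMod 2) (l : List α) :
    dl (fun m => a * F m) l = a * dl F l := by
  induction l generalizing F with
  | nil => simp [dl]
  | cons x l ih => simp only [dl, ih, mul_add]

lemma dl_congr {α : Type*} (F G : List α → ZMod 2) (l : List α)
    (h : ∀ m, m.Sublist l → F m = G m) : dl F l = dl G l := by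
  induction l generalizing F G with
  | nil => simp [dl]
  | cons x l ih =>
    simp only [dl]
    rw [h l (List.sublist_cons_self x l), ih]
    intro m hm
    exact h _ (hm.cons_cons x)

lemma dl_perm {α : Type*} {l l' : List α} (hl : l.Perm l') (F : List α → ZMod 2)
    (hF : ∀ m m' : List α, m.Perm m' → F m = F m') : dl F l = dl F l' := by
  induction hl generalizing F with
  | nil => rfl
  | cons x h ih =>
    simp only [dl]
    rw [hF _ _ h, ih]
    intro m m' hm
    exact hF _ _ (hm.cons x)
  | swap x y l =>
    simp only [dl]
    have : (fun m => F (y :: x :: m)) = (fun m => F (x :: y :: m)) := by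
      funext m
      exact hF _ _ (List.Perm.swap x y m)
    rw [this]; ring
  | trans h1 h2 ih1 ih2 => rw [ih1 F hF, ih2 F hF]

/-- Alternating-parity indicator. -/
def alt : ZMod 2 → List ℕ → ZMod 2
  | _, [] => 1
  | b, x :: l => ((x : ZMod 2) + b) * alt (b + 1) l

lemma two_aux (X b : ZMod 2) : X + b ≠ 0 → X + (b + 1) ≠ 0 → False := by
  revert X b; decide

lemma two_cancel (b : ZMod 2) : b + 1 + 1 = b := by revert b; decide

lemma dl_alt (b : ZMod 2) (l : List ℕ) : dl (alt b) l = alt b l + alt (b + 1) l := by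
  induction l generalizing b with
  | nil => simp only [dl, alt]; decide
  | cons x l ih =>
    simp only [dl, alt, dl_mul, ih, two_cancel]
    generalize alt b l = A
    generalize alt (b + 1) l = B
    generalize (x : ZMod 2) = X
    revert A B X b
    decide

/-- Opposite label. -/
def flip (m : ℕ) : ℕ := 2 * (m / 2) + (1 - m % 2)

/-- No complementary pair. -/
def NC (l : List ℕ) : Prop := ∀ a ∈ l, ∀ b ∈ l, a ≠ flip b

lemma cast_flip (m : ℕ) : ((flip m : ℕ) : ZMod 2) = (m : ZMod 2) + 1 := by
  have h : m % 2 = 0 ∨ m % 2 = 1 := by omega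
  have : ((flip m : ℕ) : ZMod 2) = ((m + 1 : ℕ) : ZMod 2) := by
    rw [ZMod.natCast_eq_natCast_iff']
    unfold flip
    omega
  rw [this]; push_cast; rfl

lemma alt_flip (b : ZMod 2) (l : List ℕ) : alt b (l.map flip) = alt (b + 1) l := by
  induction l generalizing b with
  | nil => rfl
  | cons x l ih =>
    simp only [List.map, alt, ih, cast_flip]
    ring

/-- Sorted alternating indicator. -/
def pp (b : ZMod 2) (l : List ℕ) : ZMod 2 := alt b (l.insertionSort (· ≤ ·))

lemma pp_perm (b : ZMod 2) (m m' : List ℕ) (h : m.Perm m') : pp b m = pp b m' := by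
  unfold pp
  rw [List.Perm.eq_of_pairwise (le := (· ≤ ·)) (l₁ := m.insertionSort (· ≤ ·)) (l₂ := m'.insertionSort (· ≤ ·))]
  · intro a b _ _ h1 h2; exact le_antisymm h1 h2
  · exact List.pairwise_insertionSort _ _
  · exact List.pairwise_insertionSort _ _
  · exact ((List.perm_insertionSort _ _).trans h).trans (List.perm_insertionSort _ _).symm

lemma dl_pp (b : ZMod 2) (l : List ℕ) : dl (pp b) l = pp b l + pp (b + 1) l := by
  rw [dl_perm (List.perm_insertionSort (· ≤ ·) l).symm _ (pp_perm b)]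
  rw [dl_congr (pp b) (alt b), dl_alt]
  · rfl
  · intro m hm
    unfold pp
    rw [List.Pairwise.insertionSort_eq]
    exact (List.pairwise_insertionSort (· ≤ ·) l).sublist hm

lemma pp_flip (b : ZMod 2) (l : List ℕ) (h : NC l) : pp b (l.map flip) = pp (b + 1) l := by
  unfold pp
  rw [← alt_flip]
  congr 1
  apply List.Perm.eq_of_pairwise (le := (· ≤ ·))
  · intro a b _ _ h1 h2; exact le_antisymm h1 h2
  · exact List.pairwise_insertionSort _ _
  · rw [List.pairwise_map]
    apply List.Pairwise.imp_of_mem _ (List.pairwise_insertionSort (· ≤ ·) l)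
    intro x y hx hy hxy
    have h1 := h x ((List.mem_insertionSort _).1 hx) y ((List.mem_insertionSort _).1 hy)
    simp only [flip] at *
    omega
  · exact (List.perm_insertionSort _ _).trans ((List.perm_insertionSort _ _).symm.map _)

lemma alt_strict (b : ZMod 2) (l : List ℕ) (h : NC l) (hs : l.Pairwise (· ≤ ·))
    (hb : alt b l ≠ 0) : (l.map (· / 2)).Pairwise (· < ·) := by
  induction l generalizing b with
  | nil => simp
  | cons x l ih =>
    have h2 : alt (b + 1) l ≠ 0 := by
      intro h0; apply hb; simp [alt, h0]
    have h3 : (x : ZMod 2) + b ≠ 0 := by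
      intro h0; apply hb; simp [alt, h0]
    have hl := ih (b + 1) (fun a ha c hc => h a (List.mem_cons_of_mem _ ha) c
      (List.mem_cons_of_mem _ hc)) (List.pairwise_cons.1 hs).2 h2
    cases l with
    | nil => simp
    | cons y l =>
      have h4 : (y : ZMod 2) + (b + 1) ≠ 0 := by
        intro h0; apply h2; simp [alt, h0]
      have hxy : x ≤ y := (List.pairwise_cons.1 hs).1 y (by simp)
      have hne : x ≠ y := by
        rintro rfl
        exact two_aux _ _ h3 h4
      have h5 := h y (by simp) x (by simp)
      have h6 : x / 2 < y / 2 := by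
        simp only [flip] at h5
        omega
      simp only [List.map] at hl ⊢
      rw [List.pairwise_cons]
      refine ⟨?_, hl⟩
      intro a ha
      rcases List.mem_cons.1 ha with rfl | ha
      · exact h6
      · exact h6.trans ((List.pairwise_cons.1 hl).1 a ha)

lemma pp_eq_zero (b : ZMod 2) (n : ℕ) (l : List ℕ) (h : NC l) (hl : ∀ a ∈ l, a / 2 < n)
    (hlen : l.length = n + 1) : pp b l = 0 := by
  by_contra h0
  have hp := List.perm_insertionSort (· ≤ ·) l
  have h1 := alt_strict b _ (fun a ha c hc => h a (hp.mem_iff.1 ha) c (hp.mem_iff.1 hc))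
    (List.pairwise_insertionSort (· ≤ ·) l) h0
  have h2 : ((l.insertionSort (· ≤ ·)).map (· / 2)).Nodup := h1.imp (fun h => ne_of_lt h)
  have h3 := List.toFinset_card_of_nodup h2
  have h4 : ((l.insertionSort (· ≤ ·)).map (· / 2)).toFinset ⊆ Finset.range n := by
    intro a ha
    simp only [List.mem_toFinset, List.mem_map] at ha
    obtain ⟨c, hc, rfl⟩ := ha
    exact Finset.mem_range.2 (hl c (hp.mem_iff.1 hc))
  have h5 := Finset.card_le_card h4
  rw [h3] at h5
  simp [hlen] at h5

end Fan

section Eval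
variable {V : Type*}

lemma lc_bd0 (F : List V → ZMod 2) (σ : List V) :
    Finsupp.linearCombination (ZMod 2) F (bd0 σ) = dl F σ := by
  induction σ generalizing F with
  | nil => simp [bd0, dl]
  | cons x l ih =>
    have h : ∀ c : Ch V, Finsupp.linearCombination (ZMod 2) F (consL x c) =
        Finsupp.linearCombination (ZMod 2) (fun m => F (x :: m)) c := by
      intro c
      simp only [consL, Finsupp.lmapDomain_apply, Finsupp.linearCombination_mapDomain]
      rfl
    rw [bd0, map_add, h, ih, dl]
    simp

lemma dl_map {α β : Type*} (g : α → β) (F : List β → ZMod 2) (l : List α) :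
    dl (fun m => F (m.map g)) l = dl F (l.map g) := by
  induction l generalizing F with
  | nil => rfl
  | cons x l ih =>
    simp only [dl, List.map]
    rw [← ih]

/-- Evaluation of the Fan cochain on chains. -/
noncomputable def ev (lam : V → ℕ) (b : ZMod 2) : Ch V →ₗ[ZMod 2] ZMod 2 :=
  Finsupp.linearCombination (ZMod 2) (fun σ => pp b (σ.map lam))

lemma ev_single (lam : V → ℕ) (b : ZMod 2) (σ : List V) :
    ev lam b (Finsupp.single σ 1) = pp b (σ.map lam) := by
  simp [ev]

lemma ev_bd (lam : V → ℕ) (b : ZMod 2) (c : Ch V) :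
    ev lam b (bd c) = ev lam b c + ev lam (b + 1) c := by
  have : ev lam b ∘ₗ bd = ev lam b + ev lam (b + 1) := by
    apply Finsupp.lhom_ext'
    intro l
    ext1
    simp only [LinearMap.comp_apply, Finsupp.lsingle_apply, bd_single, LinearMap.add_apply,
      ev_single]
    rw [ev, lc_bd0, dl_map, dl_pp]
  exact LinearMap.congr_fun this c

/-- Chains supported on lists satisfying `P`. -/
abbrev Sup (P : List V → Prop) : Submodule (ZMod 2) (Ch V) :=
  Finsupp.supported (ZMod 2) (ZMod 2) {σ | P σ}

lemma single_mem_Sup {P : List V → Prop} {σ : List V} (h : P σ) :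
    (Finsupp.single σ 1 : Ch V) ∈ Sup P := Finsupp.single_mem_supported _ _ h

/-- Induction for supported chains. -/
lemma Sup_induct {P : List V → Prop} {W : Type*} [AddCommGroup W] [Module (ZMod 2) W]
    (L : Ch V →ₗ[ZMod 2] W) (S : Submodule (ZMod 2) W)
    (h : ∀ σ, P σ → L (Finsupp.single σ 1) ∈ S) (c : Ch V) (hc : c ∈ Sup P) : L c ∈ S := by
  unfold Sup at hc
  rw [Finsupp.supported_eq_span_single] at hc
  have : Submodule.span (ZMod 2) ((fun i => (Finsupp.single i 1 : Ch V)) '' {σ | P σ}) ≤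
      S.comap L := by
    rw [Submodule.span_le]
    rintro _ ⟨σ, hσ, rfl⟩
    exact h σ hσ
  exact this hc

lemma Sup_mono {P Q : List V → Prop} (h : ∀ σ, P σ → Q σ) : Sup P ≤ Sup Q :=
  Finsupp.supported_mono h

variable [AddCommGroup V]

/-- Lists on which the labelling is antipodal and complement-free. -/
def Nice (lam : V → ℕ) (σ : List V) : Prop :=
  (∀ v ∈ σ, lam (-v) = flip (lam v)) ∧ NC (σ.map lam)

lemma ev_anti (lam : V → ℕ) (b : ZMod 2) (c : Ch V) (hc : c ∈ Sup (Nice lam)) :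
    ev lam b (anti c) = ev lam (b + 1) c := by
  have := Sup_induct (ev lam b ∘ₗ anti - ev lam (b + 1)) ⊥ (P := Nice lam) (by
    intro σ hσ
    simp only [LinearMap.sub_apply, LinearMap.comp_apply, anti_single, ev_single, Submodule.mem_bot]
    rw [← pp_flip _ _ hσ.2, sub_eq_zero]
    congr 1
    simp only [List.map_map]
    apply List.map_congr_left
    intro v hv
    exact hσ.1 v hv) c hc
  simpa [sub_eq_zero] using this

lemma fan (lam : V → ℕ) (n : ℕ) (H : ℕ → Ch V) (h0 : bd (H 0) = Finsupp.single [] 1)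
    (hS : ∀ k, bd (H (k + 1)) = H k + anti (H k))
    (hN : ∀ k ≤ n, H k ∈ Sup (Nice lam))
    (hn : H n ∈ Sup (fun σ => Nice lam σ ∧ σ.length = n + 1 ∧ ∀ v ∈ σ, lam v / 2 < n)) : False := by
  have key : ∀ k ≤ n, ev lam 0 (H k) + ev lam 1 (H k) = 1 := by
    intro k
    induction k with
    | zero =>
      intro _
      have := ev_bd lam 0 (H 0)
      rw [h0, ev_single, zero_add] at this
      rw [← this]
      rfl
    | succ k ih =>
      intro hk
      have := ev_bd lam 0 (H (k + 1))
      rw [hS, map_add, ev_anti _ _ _ (hN k (by omega)), zero_add, ih (by omega)] at this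
      exact this.symm
  have hz : ∀ b, ev lam b (H n) = 0 := by
    intro b
    have := Sup_induct (ev lam b) ⊥ (by
      intro σ hσ
      obtain ⟨h1, h2, h3⟩ := hσ
      rw [ev_single, Submodule.mem_bot]
      apply pp_eq_zero b n _ h1.2
      · intro a ha
        obtain ⟨v, hv, rfl⟩ := List.mem_map.1 ha
        exact h3 v hv
      · simpa using h2) _ hn
    simpa using this
  have := key n le_rfl
  rw [hz, hz] at this
  exact absurd this (by decide)

end Eval

lemma bd0_mem {V : Type*} (σ : List V) : bd0 σ ∈ Sup (fun τ => τ.Sublist σ ∧ τ.length + 1 = σ.length) := by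
  induction σ with
  | nil => simp [bd0]
  | cons x l ih =>
    rw [bd0]
    apply Submodule.add_mem
    · apply single_mem_Sup
      simp
    · refine Sup_induct (consL x) _ ?_ _ ih
      rintro τ ⟨h1, h2⟩
      rw [consL_single]
      apply single_mem_Sup
      refine ⟨h1.cons_cons x, by simp [h2]⟩

section Geom
variable {E : Type*} [NormedAddCommGroup E] [NormedSpace ℝ E]

/-- Barycentre of a list. -/
noncomputable def bary (σ : List E) : E := (σ.length : ℝ)⁻¹ • σ.sum

lemma bary_neg (l : List E) : bary (l.map (fun v => -v)) = - bary l := by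
  have : (l.map (fun v => -v)).sum = - l.sum := by
    induction l with
    | nil => simp
    | cons x l ih => simp [ih]; abel
  simp [bary, this]

lemma bary_mem (σ : List E) (h : σ ≠ []) : bary σ ∈ convexHull ℝ {x | x ∈ σ} := by
  have hc := convex_convexHull ℝ {x | x ∈ σ}
  have hpos : (0 : ℝ) < σ.length := by
    have := List.length_pos_iff.2 h
    exact_mod_cast this
  have h1 : σ.sum = ∑ i : Fin σ.length, σ.get i := by
    conv_lhs => rw [← List.ofFn_get σ, List.sum_ofFn]
  unfold bary
  rw [h1, Finset.smul_sum]
  apply hc.sum_mem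
  · intro i _; positivity
  · simp; field_simp
  · intro i _
    exact subset_convexHull ℝ _ (List.get_mem σ i)

lemma sum_dist_le (σ : List E) (v : E) (d : ℝ) (h : ∀ w ∈ σ, dist w v ≤ d) :
    ‖σ.sum - (σ.length : ℝ) • v‖ ≤ σ.length * d := by
  induction σ with
  | nil => simp
  | cons x l ih =>
    have h1 := ih (fun w hw => h w (List.mem_cons_of_mem _ hw))
    have h2 := h x (by simp)
    rw [dist_eq_norm] at h2
    have : (x :: l).sum - ((x :: l).length : ℝ) • v = (x - v) + (l.sum - (l.length : ℝ) • v) := by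
      simp [add_smul]; abel
    rw [this]
    refine (norm_add_le _ _).trans ?_
    simp only [List.length_cons]; push_cast
    linarith

lemma bary_dist (σ : List E) (d : ℝ) (hd : 0 ≤ d) (N : ℕ) (hN : σ.length ≤ N + 1)
    (h : ∀ v ∈ σ, ∀ w ∈ σ, dist v w ≤ d)
    (v : E) (hv : v ∈ σ) : dist (bary σ) v ≤ (N / (N + 1) : ℝ) * d := by
  classical
  have hp := List.perm_cons_erase hv
  have hlen := hp.length_eq
  have hsum := hp.sum_eq
  have h1 := sum_dist_le (σ.erase v) v d (fun w hw => h w (List.mem_of_mem_erase hw) v hv)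
  set l := σ.erase v
  simp only [List.length_cons] at hlen
  have : bary σ - v = ((l.length : ℝ) + 1)⁻¹ • (l.sum - (l.length : ℝ) • v) := by
    have h0 : ((l.length : ℝ) + 1) ≠ 0 := by positivity
    unfold bary
    rw [hlen, hsum]
    push_cast
    rw [eq_inv_smul_iff₀ h0, smul_sub, smul_inv_smul₀ h0]
    simp [add_smul]; abel
  rw [dist_eq_norm, this, norm_smul, norm_inv, Real.norm_of_nonneg (by positivity)]
  have h3 : (l.length : ℝ) ≤ N := by
    have : l.length ≤ N := by omega
    exact_mod_cast this
  calc ((l.length : ℝ) + 1)⁻¹ * ‖l.sum - (l.length : ℝ) • v‖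
      ≤ ((l.length : ℝ) + 1)⁻¹ * (l.length * d) := by gcongr
    _ = (l.length / ((l.length : ℝ) + 1)) * d := by field_simp
    _ ≤ _ := by
      gcongr ?_ * d
      rw [div_le_div_iff₀ (by positivity) (by positivity)]
      nlinarith

lemma sd_mem (N : ℕ) (d : ℝ) (hd : 0 ≤ d) (k : ℕ) (hk : k ≤ N + 1) (σ : List E) (hσ : σ.length = k)
    (hdσ : ∀ v ∈ σ, ∀ w ∈ σ, dist v w ≤ d) :
    sd bary k (Finsupp.single σ 1) ∈ Sup (fun τ => τ.length = k ∧
      (∀ v ∈ τ, v ∈ convexHull ℝ {x | x ∈ σ}) ∧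
      ∀ v ∈ τ, ∀ w ∈ τ, dist v w ≤ (N / (N + 1) : ℝ) * d) := by
  induction k generalizing σ with
  | zero =>
    obtain rfl := List.length_eq_zero_iff.1 hσ
    simp only [sd, LinearMap.id_apply]
    apply single_mem_Sup
    simp
  | succ k ih =>
    rw [sd_single]
    have hr : 0 ≤ (N / (N + 1) : ℝ) * d := by positivity
    have h1 : sd bary k (bd0 σ) ∈ Sup (fun τ => τ.length = k ∧
      (∀ v ∈ τ, v ∈ convexHull ℝ {x | x ∈ σ}) ∧
      ∀ v ∈ τ, ∀ w ∈ τ, dist v w ≤ (N / (N + 1) : ℝ) * d) := by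
      refine Sup_induct (sd bary k) _ ?_ _ (bd0_mem σ)
      rintro τ ⟨hs, hl⟩
      refine Sup_mono ?_ (ih (by omega) τ (by omega)
        (fun v hv w hw => hdσ v (hs.subset hv) w (hs.subset hw)))
      rintro ρ ⟨a1, a2, a3⟩
      exact ⟨a1, fun v hv => convexHull_mono (fun x hx => hs.subset hx) (a2 v hv), a3⟩
    refine Sup_induct (consL (bary σ)) _ ?_ _ h1
    rintro τ ⟨a1, a2, a3⟩
    rw [consL_single]
    apply single_mem_Sup
    have hb : bary σ ∈ convexHull ℝ {x | x ∈ σ} := by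
      apply bary_mem
      rintro rfl
      simp at hσ
    have hbd : ∀ v ∈ convexHull ℝ {x | x ∈ σ}, dist v (bary σ) ≤ (N / (N + 1) : ℝ) * d := by
      have : convexHull ℝ {x | x ∈ σ} ⊆ Metric.closedBall (bary σ) ((N / (N + 1) : ℝ) * d) := by
        apply convexHull_min _ (convex_closedBall _ _)
        intro v hv
        rw [Metric.mem_closedBall, dist_comm]
        exact bary_dist σ d hd N (by omega) hdσ v hv
      intro v hv
      exact Metric.mem_closedBall.1 (this hv)
    refine ⟨by simp [a1], ?_, ?_⟩
    · intro v hv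
      rcases List.mem_cons.1 hv with rfl | hv
      · exact hb
      · exact a2 v hv
    · intro v hv w hw
      rcases List.mem_cons.1 hv with rfl | hv <;> rcases List.mem_cons.1 hw with rfl | hw
      · simpa using hr
      · rw [dist_comm]; exact hbd w (a2 w hw)
      · exact hbd v (a2 v hv)
      · exact a3 v hv w hw

lemma sd_iter_mem {ι : Type*} (Q : ι → Set E) (hQ : ∀ s, Convex ℝ (Q s)) (N : ℕ) (d : ℝ)
    (hd : 0 ≤ d) (k : ℕ) (hk : k ≤ N + 1) (c : Ch E)
    (hc : c ∈ Sup (fun σ => σ.length = k ∧ (∃ s, ∀ v ∈ σ, v ∈ Q s) ∧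
      ∀ v ∈ σ, ∀ w ∈ σ, dist v w ≤ d)) (m : ℕ) :
    (sd bary k)^[m] c ∈ Sup (fun σ => σ.length = k ∧ (∃ s, ∀ v ∈ σ, v ∈ Q s) ∧
      ∀ v ∈ σ, ∀ w ∈ σ, dist v w ≤ (N / (N + 1) : ℝ) ^ m * d) := by
  induction m with
  | zero => simpa using hc
  | succ m ih =>
    rw [Function.iterate_succ_apply']
    refine Sup_induct (sd bary k) _ ?_ _ ih
    rintro σ ⟨h1, ⟨s, hs⟩, h3⟩
    refine Sup_mono ?_ (sd_mem N _ (by positivity) k hk σ h1 h3)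
    rintro τ ⟨a1, a2, a3⟩
    refine ⟨a1, ⟨s, fun v hv => convexHull_min (fun x hx => hs x hx) (hQ s) (a2 v hv)⟩, ?_⟩
    intro v hv w hw
    refine (a3 v hv w hw).trans (le_of_eq ?_)
    ring

end Geom

section BU
variable {n : ℕ}

/-- Sign vectors. -/
abbrev Sg (n : ℕ) := {s : Fin (n + 1) → ℝ // ∀ i, s i = 1 ∨ s i = -1}

/-- Facets of the cross-polytope. -/
def Q (s : Sg n) : Set (EuclideanSpace ℝ (Fin (n + 1))) :=
  {x | (∀ i, 0 ≤ s.1 i * x i) ∧ ∑ i, s.1 i * x i = 1}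

lemma Q_convex (s : Sg n) : Convex ℝ (Q s) := by
  intro x hx y hy a b ha hb hab
  refine ⟨fun i => ?_, ?_⟩
  · have h1 := mul_nonneg ha (hx.1 i)
    have h2 := mul_nonneg hb (hy.1 i)
    simp only [PiLp.add_apply, PiLp.smul_apply, smul_eq_mul]
    nlinarith
  · have : ∑ i, s.1 i * (a • x + b • y) i = a * ∑ i, s.1 i * x i + b * ∑ i, s.1 i * y i := by
      rw [Finset.mul_sum, Finset.mul_sum, ← Finset.sum_add_distrib]
      apply Finset.sum_congr rfl
      intro i _
      simp only [PiLp.add_apply, PiLp.smul_apply, smul_eq_mul]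
      ring
    rw [this, hx.2, hy.2, mul_one, mul_one, hab]

/-- The boundary of the cross-polytope. -/
def K (n : ℕ) : Set (EuclideanSpace ℝ (Fin (n + 1))) := {x | ∑ i, |x i| = 1}

lemma Q_sub (s : Sg n) : Q s ⊆ K n := by
  intro x hx
  show ∑ i, |x i| = 1
  rw [← hx.2]
  apply Finset.sum_congr rfl
  intro i _
  have h := hx.1 i
  rcases s.2 i with h1 | h1 <;> rw [h1] at h ⊢
  · rw [one_mul] at *; exact abs_of_nonneg h
  · rw [abs_of_nonpos (by linarith)]; ring

lemma K_compact : IsCompact (K n) := by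
  apply Metric.isCompact_of_isClosed_isBounded
  · exact isClosed_eq (by fun_prop) continuous_const
  · rw [isBounded_iff_forall_norm_le]
    refine ⟨1, fun x hx => ?_⟩
    have hx' : ∑ i, |x i| = 1 := hx
    have h1 : ‖x‖ ^ 2 ≤ 1 := by
      rw [EuclideanSpace.norm_sq_eq, ← hx']
      apply Finset.sum_le_sum
      intro i hi
      have h2 : |x i| ≤ 1 := by
        rw [← hx']
        exact Finset.single_le_sum (f := fun i => |x i|) (fun i _ => abs_nonneg _) hi
      rw [Real.norm_eq_abs]
      nlinarith [abs_nonneg (x i)]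
    nlinarith [norm_nonneg x]

lemma K_ne (x : EuclideanSpace ℝ (Fin (n + 1))) (hx : x ∈ K n) : x ≠ 0 := by
  rintro rfl
  have : ∑ i : Fin (n + 1), |(0 : EuclideanSpace ℝ (Fin (n + 1))) i| = 1 := hx
  simp at this

/-- Standard basis vectors, extended by zero. -/
noncomputable def ee (n : ℕ) (i : ℕ) : EuclideanSpace ℝ (Fin (n + 1)) :=
  if h : i < n + 1 then EuclideanSpace.single ⟨i, h⟩ 1 else 0

lemma hem_mem (k : ℕ) (hk : k ≤ n) : hem (ee n) k ∈ Sup (fun σ => σ.length = k + 1 ∧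
    ∃ s : Sg n, ∀ v ∈ σ, ∃ i : Fin (n + 1), i.1 ≤ k ∧ v = EuclideanSpace.single i (s.1 i)) := by
  induction k with
  | zero =>
    rw [hem]
    apply single_mem_Sup
    refine ⟨rfl, ⟨fun _ => 1, fun _ => Or.inl rfl⟩, ?_⟩
    intro v hv
    refine ⟨0, le_rfl, ?_⟩
    rw [List.mem_singleton.1 hv]
    simp [ee]
  | succ k ih =>
    have ih := ih (by omega)
    rw [hem]
    have h2 : anti (hem (ee n) k) ∈ Sup (fun σ => σ.length = k + 1 ∧
        ∃ s : Sg n, ∀ v ∈ σ, ∃ i : Fin (n + 1), i.1 ≤ k ∧ v = EuclideanSpace.single i (s.1 i)) := by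
      refine Sup_induct anti _ ?_ _ ih
      rintro σ ⟨h1, s, hs⟩
      rw [anti_single]
      apply single_mem_Sup
      refine ⟨by simpa using h1, ⟨fun i => - s.1 i, fun i => ?_⟩, ?_⟩
      · rcases s.2 i with h | h <;> simp [h]
      · intro v hv
        obtain ⟨w, hw, rfl⟩ := List.mem_map.1 hv
        obtain ⟨i, hi, rfl⟩ := hs w hw
        refine ⟨i, hi, ?_⟩
        ext j
        by_cases hj : j = i
        · subst hj; simp
        · simp [hj]
    refine Sup_induct (consL (ee n (k + 1))) _ ?_ _ (Submodule.add_mem _ ih h2)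
    rintro σ ⟨h1, s, hs⟩
    rw [consL_single]
    apply single_mem_Sup
    refine ⟨by simpa using h1, ⟨fun i => if i.1 ≤ k then s.1 i else 1, fun i => ?_⟩, ?_⟩
    · by_cases h : i.1 ≤ k
      · simpa [h] using s.2 i
      · simp [h]
    · intro v hv
      rcases List.mem_cons.1 hv with rfl | hv
      · refine ⟨⟨k + 1, by omega⟩, le_rfl, ?_⟩
        simp [ee, hk]
      · obtain ⟨i, hi, rfl⟩ := hs v hv
        refine ⟨i, by omega, ?_⟩
        simp [hi]

lemma single_mem_Q (s : Sg n) (i : Fin (n + 1)) : EuclideanSpace.single i (s.1 i) ∈ Q s := by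
  have hs : s.1 i * s.1 i = 1 := by rcases s.2 i with h | h <;> simp [h]
  refine ⟨fun j => ?_, ?_⟩
  · by_cases hj : j = i
    · subst hj; simp [hs]
    · simp [hj]
  · rw [Finset.sum_eq_single i]
    · simp [hs]
    · intro j _ hj; simp [hj]
    · simp

lemma hs_mem (k : ℕ) (hk : k ≤ n) (m : ℕ) : hs bary (ee n) m k ∈ Sup (fun σ =>
    σ.length = k + 1 ∧ (∃ s : Sg n, ∀ v ∈ σ, v ∈ Q s) ∧
      ∀ v ∈ σ, ∀ w ∈ σ, dist v w ≤ (n / (n + 1) : ℝ) ^ m * 2) := by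
  apply sd_iter_mem Q Q_convex n 2 (by norm_num) (k + 1) (by omega)
  refine Sup_mono ?_ (hem_mem k hk)
  rintro σ ⟨h1, s, hs⟩
  have hnorm : ∀ v ∈ σ, ‖v‖ = 1 := by
    intro v hv
    obtain ⟨i, _, rfl⟩ := hs v hv
    rcases s.2 i with h | h <;> simp [h]
  refine ⟨h1, ⟨s, ?_⟩, ?_⟩
  · intro v hv
    obtain ⟨i, _, rfl⟩ := hs v hv
    exact single_mem_Q s i
  · intro v hv w hw
    rw [dist_eq_norm]
    refine (norm_sub_le _ _).trans ?_
    rw [hnorm v hv, hnorm w hw]; norm_num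

/-- **Borsuk–Ulam**: an odd map `ℝ^{n+1} ∖ 0 → ℝ^n` has a zero. -/
theorem borsuk_ulam (hn : 1 ≤ n) (G : EuclideanSpace ℝ (Fin (n + 1)) → Fin n → ℝ)
    (hG : ContinuousOn G {0}ᶜ) (hodd : ∀ x, G (-x) = - G x) : ∃ x, x ≠ 0 ∧ G x = 0 := by
  classical
  by_contra! hne
  have : Nonempty (Fin n) := ⟨⟨0, hn⟩⟩
  have hGK : ContinuousOn G (K n) := hG.mono (fun x hx => K_ne x hx)
  -- lower bound
  obtain ⟨c, hc, hcK⟩ : ∃ c > 0, ∀ x ∈ K n, c ≤ ‖G x‖ := by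
    rcases (K n).eq_empty_or_nonempty with he | hK
    · exact ⟨1, one_pos, by simp [he]⟩
    · obtain ⟨x, hx, hmin⟩ := K_compact.exists_isMinOn hK hGK.norm
      exact ⟨‖G x‖, norm_pos_iff.2 (hne x (K_ne x hx)), fun y hy => hmin hy⟩
  have huc := K_compact.uniformContinuousOn_of_continuous hGK
  obtain ⟨η, hη, hηK⟩ := Metric.uniformContinuousOn_iff.1 huc c hc
  have hmax : ∀ w : Fin n → ℝ, ∃ j, ∀ i, w i ≤ w j := fun w => Finite.exists_max w
  choose jj hjj using hmax
  let J : EuclideanSpace ℝ (Fin (n + 1)) → Fin n := fun x => jj (fun i => |G x i|)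
  have hJneg : ∀ x, J (-x) = J x := by
    intro x
    simp only [J, hodd, Pi.neg_apply, abs_neg]
  have hJ : ∀ x, ‖G x‖ ≤ |G x (J x)| := by
    intro x
    rw [pi_norm_le_iff_of_nonneg (abs_nonneg _)]
    intro i
    exact hjj (fun i => |G x i|) i
  let lam : EuclideanSpace ℝ (Fin (n + 1)) → ℕ := fun x =>
    2 * (J x).1 + if 0 < G x (J x) then 1 else 0
  have hlam2 : ∀ x, lam x / 2 = (J x).1 := by
    intro x
    simp only [lam]
    split_ifs <;> omega
  have hlamneg : ∀ x ∈ K n, lam (-x) = flip (lam x) := by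
    intro x hx
    have h1 := (hcK x hx).trans (hJ x)
    have h2 : G x (J x) ≠ 0 := by
      intro h; rw [h, abs_zero] at h1; linarith
    simp only [lam, hJneg, hodd, Pi.neg_apply, flip]
    rcases lt_or_gt_of_ne h2 with h3 | h3
    · rw [if_pos (by linarith), if_neg (by linarith)]; omega
    · rw [if_neg (by linarith), if_pos (by linarith)]; omega
  have hlamnc : ∀ x ∈ K n, ∀ y ∈ K n, dist x y < η → lam x ≠ flip (lam y) := by
    intro x hx y hy hxy h
    have hd := hηK x hx y hy hxy
    have hxJ := (hcK x hx).trans (hJ x)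
    have hyJ := (hcK y hy).trans (hJ y)
    have hJJ : J x = J y := by
      apply Fin.ext
      rw [← hlam2, ← hlam2, h]
      simp only [flip]; omega
    have hcomp : |G x (J x) - G y (J x)| < c := by
      have := (dist_le_pi_dist (G x) (G y) (J x)).trans_lt hd
      rwa [Real.dist_eq] at this
    rw [← hJJ] at hyJ
    simp only [lam, flip, ← hJJ] at h
    rw [abs_lt] at hcomp
    by_cases h1 : 0 < G x (J x) <;> by_cases h2 : 0 < G y (J x)
    · simp only [h1, h2, if_true] at h; omega
    · rw [abs_of_pos h1] at hxJ
      linarith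
    · rw [abs_of_pos h2] at hyJ
      linarith
    · simp only [h1, h2, if_false] at h; omega
  obtain ⟨m, hm⟩ : ∃ m : ℕ, (n / (n + 1) : ℝ) ^ m < η / 2 :=
    exists_pow_lt_of_lt_one (by positivity) (by rw [div_lt_one (by positivity)]; linarith)
  have hnice : ∀ k ≤ n, hs bary (ee n) m k ∈ Sup (fun σ => Nice lam σ ∧ σ.length = k + 1 ∧
      ∀ v ∈ σ, lam v / 2 < n) := by
    intro k hk
    refine Sup_mono ?_ (hs_mem k hk m)
    rintro σ ⟨h1, ⟨s, hsQ⟩, h3⟩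
    refine ⟨⟨fun v hv => hlamneg v (Q_sub s (hsQ v hv)), ?_⟩, h1, ?_⟩
    · intro a ha b hb
      obtain ⟨v, hv, rfl⟩ := List.mem_map.1 ha
      obtain ⟨w, hw, rfl⟩ := List.mem_map.1 hb
      apply hlamnc v (Q_sub s (hsQ v hv)) w (Q_sub s (hsQ w hw))
      have := h3 v hv w hw
      linarith
    · intro v _
      rw [hlam2]
      exact (J v).2
  exact fan lam n (hs bary (ee n) m) (bd_hs_zero _ _ _) (bd_hs_succ _ bary_neg _ _)
    (fun k hk => Sup_mono (fun σ h => h.1) (hnice k hk)) (hnice n le_rfl)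

end BU

section Reduction
variable {E : Type*} [NormedAddCommGroup E] [InnerProductSpace ℝ E]

/-- Component orthogonal to `p`. -/
noncomputable def yy (p z : E) : E := z - ⟪p, z⟫ • p

/-- Normalised orthogonal component. -/
noncomputable def uu (p z : E) : E := ‖yy p z‖⁻¹ • yy p z

/-- Clamped centre parameter of the geodesic arc. -/
noncomputable def cc (δ : ℝ) (p z : E) : ℝ := (δ / 2) * max (-1) (min 1 (⟪p, z⟫ / ‖yy p z‖))

/-- Point at parameter `t` of the geodesic through `p` in direction `u`. -/
noncomputable def gam (p u : E) (t : ℝ) : E := Real.cos t • p + Real.sin t • u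

lemma yy_neg (p z : E) : yy p (-z) = - yy p z := by
  simp [yy]; abel

lemma uu_neg (p z : E) : uu p (-z) = - uu p z := by
  simp [uu, yy_neg]

lemma clamp_neg (a r : ℝ) (hr : 0 ≤ r) : max (-r) (min r (-a)) = - max (-r) (min r a) := by
  simp only [min_def, max_def]
  split_ifs <;> linarith

lemma cc_neg (δ : ℝ) (p z : E) : cc δ p (-z) = - cc δ p z := by
  simp only [cc, yy_neg, norm_neg, inner_neg_right, neg_div]
  rw [clamp_neg _ 1 zero_le_one]; ring

lemma gam_neg (p u : E) (t : ℝ) : gam p (-u) t = gam p u (-t) := by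
  simp [gam]

lemma norm_gam (p u : E) (hp : ‖p‖ = 1) (hu : ‖u‖ = 1) (h : ⟪p, u⟫ = 0) (t : ℝ) :
    ‖gam p u t‖ = 1 := by
  have h1 : ‖gam p u t‖ ^ 2 = 1 := by
    rw [gam, norm_add_sq_real, norm_smul, norm_smul, inner_smul_left, inner_smul_right, h, hp, hu]
    simp
  have h2 := norm_nonneg (gam p u t)
  nlinarith

lemma inner_gam (p u : E) (hp : ‖p‖ = 1) (hu : ‖u‖ = 1) (h : ⟪p, u⟫ = 0) (a b : ℝ) :
    ⟪gam p u a, gam p u b⟫ = Real.cos (a - b) := by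
  have h' : ⟪u, p⟫ = 0 := by rw [real_inner_comm]; exact h
  simp only [gam, inner_add_left, inner_add_right, inner_smul_left, inner_smul_right, h, h',
    real_inner_self_eq_norm_sq, hp, hu, Real.cos_sub]
  simp
  ring

lemma gam_add (p u : E) (a b : ℝ) : gam p u (a + b) =
    Real.cos b • gam p u a + Real.sin b • gam p u (a + Real.pi / 2) := by
  simp only [gam, Real.cos_add, Real.sin_add, Real.cos_pi_div_two, Real.sin_pi_div_two]
  module

lemma inner_yy (p z : E) (hp : ‖p‖ = 1) : ⟪p, yy p z⟫ = 0 := by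
  simp [yy, inner_sub_right, inner_smul_right, hp]

lemma inner_uu (p z : E) (hp : ‖p‖ = 1) : ⟪p, uu p z⟫ = 0 := by
  simp [uu, inner_smul_right, inner_yy p z hp]

lemma norm_uu (p z : E) (h : yy p z ≠ 0) : ‖uu p z‖ = 1 := by
  rw [uu, norm_smul, norm_inv, norm_norm, inv_mul_cancel₀ (norm_ne_zero_iff.2 h)]

lemma continuous_yy (p : E) : Continuous (yy p) := by
  unfold yy; fun_prop

lemma continuousOn_gam (δ e : ℝ) (p : E) :
    ContinuousOn (fun z => gam p (uu p z) (cc δ p z + e)) {z | yy p z ≠ 0} := by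
  have h1 := (continuous_yy p)
  have h2 : ∀ z ∈ {z | yy p z ≠ 0}, ‖yy p z‖ ≠ 0 := fun z hz => norm_ne_zero_iff.2 hz
  have h3 : ContinuousOn (uu p) {z | yy p z ≠ 0} := by
    unfold uu
    exact (h1.norm.continuousOn.inv₀ h2).smul h1.continuousOn
  have h4 : ContinuousOn (cc δ p) {z | yy p z ≠ 0} := by
    unfold cc
    have h5 : ContinuousOn (fun z => ⟪p, z⟫ / ‖yy p z‖) {z | yy p z ≠ 0} :=
      ContinuousOn.div (by fun_prop) h1.norm.continuousOn h2
    have h6 : Continuous (fun t : ℝ => max (-1) (min 1 t)) := by fun_prop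
    exact continuousOn_const.mul (h6.comp_continuousOn h5)
  unfold gam
  exact ((Real.continuous_cos.comp_continuousOn (h4.add continuousOn_const)).smul
    continuousOn_const).add
    ((Real.continuous_sin.comp_continuousOn (h4.add continuousOn_const)).smul h3)

variable {W : Type*} [NormedAddCommGroup W] [NormedSpace ℝ W]

/-- Scaled difference of `f` at the ends of the arc. -/
noncomputable def TT (f : E → W) (δ : ℝ) (p z : E) : W :=
  ‖yy p z‖ • (f (gam p (uu p z) (cc δ p z + δ / 2)) - f (gam p (uu p z) (cc δ p z + -(δ / 2))))

lemma TT_neg (f : E → W) (δ : ℝ) (p z : E) : TT f δ p (-z) = - TT f δ p z := by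
  simp only [TT, yy_neg, norm_neg, uu_neg, gam_neg, cc_neg]
  rw [← smul_neg, neg_sub]
  congr 3
  · congr 1; ring
  · congr 1; ring

lemma continuous_TT (f : E → W) (hf : ContinuousOn f (Metric.sphere 0 1)) (M : ℝ)
    (hM : ∀ x ∈ Metric.sphere (0 : E) 1, ‖f x‖ ≤ M) (δ : ℝ) (p : E) (hp : ‖p‖ = 1) :
    Continuous (TT f δ p) := by
  have hS : ∀ z, yy p z ≠ 0 → ∀ t, gam p (uu p z) t ∈ Metric.sphere (0 : E) 1 := by
    intro z hz t
    rw [mem_sphere_zero_iff_norm]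
    exact norm_gam p _ hp (norm_uu p z hz) (inner_uu p z hp) t
  rw [continuous_iff_continuousAt]
  intro z
  by_cases hz : yy p z = 0
  · have h0 : TT f δ p z = 0 := by simp [TT, hz]
    rw [ContinuousAt, h0]
    apply squeeze_zero_norm (a := fun w => ‖yy p w‖ * (M + M))
    · intro w
      by_cases hw : yy p w = 0
      · simp [TT, hw]
      · rw [TT, norm_smul, norm_norm]
        gcongr
        exact (norm_sub_le _ _).trans (add_le_add (hM _ (hS w hw _)) (hM _ (hS w hw _)))
    · have : Continuous (fun w => ‖yy p w‖ * (M + M)) := (continuous_yy p).norm.mul_const _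
      have h := this.tendsto z
      simpa [hz] using h
  · have hopen : IsOpen {z | yy p z ≠ 0} := isOpen_ne_fun (continuous_yy p) continuous_const
    have : ContinuousOn (TT f δ p) {z | yy p z ≠ 0} := by
      unfold TT
      refine (continuous_yy p).norm.continuousOn.smul (ContinuousOn.sub ?_ ?_)
      · exact hf.comp (continuousOn_gam δ _ p) (fun w hw => hS w hw _)
      · exact hf.comp (continuousOn_gam δ _ p) (fun w hw => hS w hw _)
    exact this.continuousAt (hopen.mem_nhds hz)

end Reduction
end HopfSphere

/-- **Hopf's theorem for the round sphere**: for every `n ≥ 1`, every continuous map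
`f : S^n → ℝ^n` and every prescribed `δ > 0`, there exist a unit vector `x` and a unit
vector `u` orthogonal to `x` such that `f x = f (cos δ • x + sin δ • u)`, i.e. the two
endpoints of some geodesic arc of length `δ` on `S^n` are mapped by `f` to a single
point. -/
theorem hopf_round_sphere (n : ℕ) (hn : 1 ≤ n)
    (f : EuclideanSpace ℝ (Fin (n + 1)) → EuclideanSpace ℝ (Fin n))
    (hf : ContinuousOn f (Metric.sphere 0 1))
    (δ : ℝ) (hδ : 0 < δ) :
    ∃ x u : EuclideanSpace ℝ (Fin (n + 1)), ‖x‖ = 1 ∧ ‖u‖ = 1 ∧ ⟪x, u⟫ = 0 ∧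
      f x = f (Real.cos δ • x + Real.sin δ • u) := by
  classical
  by_contra! hno
  have hcomp := isCompact_sphere (0 : EuclideanSpace ℝ (Fin (n + 1))) 1
  obtain ⟨M, hM⟩ := hcomp.exists_bound_of_continuousOn hf
  let i0 : Fin n := ⟨0, hn⟩
  have hne : (Metric.sphere (0 : EuclideanSpace ℝ (Fin (n + 1))) 1).Nonempty :=
    NormedSpace.sphere_nonempty.2 zero_le_one
  have hfi : ContinuousOn (fun x => f x i0) (Metric.sphere 0 1) :=
    (EuclideanSpace.proj (𝕜 := ℝ) i0).continuous.comp_continuousOn hf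
  obtain ⟨p, hpS, hpmax⟩ := hcomp.exists_isMaxOn hne hfi
  have hp : ‖p‖ = 1 := mem_sphere_zero_iff_norm.1 hpS
  let G : EuclideanSpace ℝ (Fin (n + 1)) → Fin n → ℝ := fun z i =>
    HopfSphere.TT f δ p z i - (⟪p, z⟫ - max (-‖HopfSphere.yy p z‖) (min ‖HopfSphere.yy p z‖ ⟪p, z⟫)) *
      (if i = i0 then 1 else 0)
  have hTT := HopfSphere.continuous_TT f hf M hM δ p hp
  have hyy := HopfSphere.continuous_yy p
  have hG : Continuous G := by
    apply continuous_pi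
    intro i
    have h1 : Continuous (fun z => HopfSphere.TT f δ p z i) :=
      (EuclideanSpace.proj (𝕜 := ℝ) i).continuous.comp hTT
    have h2 : Continuous (fun z : EuclideanSpace ℝ (Fin (n + 1)) => ⟪p, z⟫) := by fun_prop
    exact h1.sub ((h2.sub (hyy.norm.neg.max (hyy.norm.min h2))).mul continuous_const)
  have hodd : ∀ z, G (-z) = - G z := by
    intro z
    funext i
    simp only [G, HopfSphere.TT_neg, HopfSphere.yy_neg, norm_neg, inner_neg_right, Pi.neg_apply,
      HopfSphere.clamp_neg _ _ (norm_nonneg _), PiLp.neg_apply]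
    ring
  obtain ⟨z, hz, hGz⟩ := HopfSphere.borsuk_ulam hn G hG.continuousOn hodd
  have hGi : ∀ i, G z i = 0 := fun i => by rw [hGz]; rfl
  by_cases hy : HopfSphere.yy p z = 0
  · have h0 := hGi i0
    simp only [G, HopfSphere.TT, hy, norm_zero, zero_smul, PiLp.zero_apply, if_true] at h0
    have h1 : max (-0) (min 0 ⟪p, z⟫) = 0 := by simp
    rw [h1] at h0
    have h2 : ⟪p, z⟫ = 0 := by linarith
    apply hz
    have := hy
    rw [HopfSphere.yy, h2, zero_smul, sub_zero] at this
    exact this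
  have hu := HopfSphere.norm_uu p z hy
  have hpu := HopfSphere.inner_uu p z hp
  have hρ : 0 < ‖HopfSphere.yy p z‖ := norm_pos_iff.2 hy
  have hmaxu : ∀ t, f (HopfSphere.gam p (HopfSphere.uu p z) t) i0 ≤ f p i0 := by
    intro t
    exact hpmax (mem_sphere_zero_iff_norm.2 (HopfSphere.norm_gam p _ hp hu hpu t))
  have hg0 : HopfSphere.gam p (HopfSphere.uu p z) 0 = p := by simp [HopfSphere.gam]
  have h0 := hGi i0
  simp only [G, HopfSphere.TT, if_true, PiLp.smul_apply, PiLp.sub_apply, smul_eq_mul, mul_one] at h0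
  rcases lt_or_ge ‖HopfSphere.yy p z‖ ⟪p, z⟫ with h1 | h1
  · have hc : HopfSphere.cc δ p z = δ / 2 := by
      rw [HopfSphere.cc, min_eq_left ((one_le_div hρ).2 h1.le), max_eq_right (by norm_num), mul_one]
    rw [hc, min_eq_left h1.le, max_eq_right (by linarith), add_neg_cancel, hg0] at h0
    have h2 := hmaxu (δ / 2 + δ / 2)
    nlinarith
  rcases lt_or_ge ⟪p, z⟫ (-‖HopfSphere.yy p z‖) with h3 | h3
  · have hq : ⟪p, z⟫ / ‖HopfSphere.yy p z‖ ≤ -1 := by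
      rw [div_le_iff₀ hρ]; linarith
    have hc : HopfSphere.cc δ p z = -(δ / 2) := by
      rw [HopfSphere.cc, min_eq_right (by linarith), max_eq_left hq]; ring
    rw [hc, min_eq_right h1, max_eq_left h3.le, neg_add_cancel, hg0] at h0
    have h2 := hmaxu (-(δ / 2) + -(δ / 2))
    nlinarith
  · set c := HopfSphere.cc δ p z with hcdef
    apply hno (HopfSphere.gam p (HopfSphere.uu p z) (c + -(δ / 2)))
      (HopfSphere.gam p (HopfSphere.uu p z) (c + -(δ / 2) + Real.pi / 2))
      (HopfSphere.norm_gam p _ hp hu hpu _) (HopfSphere.norm_gam p _ hp hu hpu _)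
    · rw [HopfSphere.inner_gam p _ hp hu hpu]
      have : c + -(δ / 2) - (c + -(δ / 2) + Real.pi / 2) = -(Real.pi / 2) := by ring
      rw [this, Real.cos_neg, Real.cos_pi_div_two]
    · rw [← HopfSphere.gam_add]
      have he : c + -(δ / 2) + δ = c + δ / 2 := by ring
      rw [he]
      ext i
      have hi := hGi i
      simp only [G, HopfSphere.TT, PiLp.smul_apply, PiLp.sub_apply, smul_eq_mul] at hi
      rw [min_eq_right h1, max_eq_right h3, sub_self, zero_mul, sub_zero, ← hcdef] at hi
      rcases mul_eq_zero.1 hi with h | h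
      · exact absurd h hρ.ne'
      · linarith
end
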